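/- arXiv:1705.05624 — 2 statements merged into one kernel-verified Lean document; each statement's English description precedes it below -/
import Mathlib

section
/- The function f: ℝ² → ℝ defined by f(x,y) = x⁴ sin(1/x²) for x ≠ 0 and f(x,y) = 0 for x = 0 is of class C¹, is locally Lipschitz, and has an approximate first-order Taylor expansion (ap-limsup_{(u,v)→(x,y)} |f(u,v)-f(x,y)-Df(x,y)(u-x,v-y)|/|(u,v)-(x,y)|² < ∞) at every point of ℝ², but f does not belong to BV₂(ℝ²) (its distributional second derivative ∂²f/∂x² is not a finite Radon measure on any neighborhood of the line x = 0). -/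
open MeasureTheory Metric Filter Set

noncomputable section

/-- The function `f(x,y) = x⁴ sin(1/x²)` for `x ≠ 0`, `f(0,y) = 0`. -/
def whitneyExample : ℝ × ℝ → ℝ :=
  fun z => if z.1 = 0 then 0 else z.1 ^ 4 * Real.sin (1 / z.1 ^ 2)

/-- The set `A` has vanishing Lebesgue density at `z ∈ ℝ²`. -/
def apSmall2 (z : ℝ × ℝ) (A : Set (ℝ × ℝ)) : Prop :=
  Tendsto (fun r : ℝ => volume (A ∩ ball z r) / volume (ball z r))
    (nhdsWithin 0 (Ioi 0)) (nhds 0)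

/-- The one-variable profile `t⁴ sin(1/t²)`, with value `0` at `0`. -/
def quarticSin (t : ℝ) : ℝ := t ^ 4 * Real.sin (1 / t ^ 2)

/-- The derivative of `quarticSin`. -/
def quarticSinDeriv (t : ℝ) : ℝ :=
  4 * t ^ 3 * Real.sin (1 / t ^ 2) - 2 * t * Real.cos (1 / t ^ 2)

/-- The second derivative of `quarticSin` away from `0`. -/
def quarticSinDeriv2 (t : ℝ) : ℝ :=
  12 * t ^ 2 * Real.sin (1 / t ^ 2) - 10 * Real.cos (1 / t ^ 2) -
    4 / t ^ 2 * Real.sin (1 / t ^ 2)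

lemma whitneyExample_eq (z : ℝ × ℝ) : whitneyExample z = quarticSin z.1 := by
  unfold whitneyExample quarticSin
  split_ifs with h <;> simp [h]

lemma hasDerivAt_one_div_sq {t : ℝ} (ht : t ≠ 0) :
    HasDerivAt (fun t : ℝ => 1 / t ^ 2) (-2 / t ^ 3) t := by
  have h := (hasDerivAt_pow 2 t).inv (pow_ne_zero 2 ht)
  simp only [one_div]
  refine h.congr_deriv ?_
  field_simp
  norm_num [mul_comm]

lemma hasDerivAt_quarticSin_of_ne {t : ℝ} (ht : t ≠ 0) :
    HasDerivAt quarticSin (quarticSinDeriv t) t := by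
  refine ((hasDerivAt_pow 4 t).mul (hasDerivAt_one_div_sq ht).sin).congr_deriv ?_
  unfold quarticSinDeriv
  field_simp
  push_cast
  ring

lemma hasDerivAt_quarticSinDeriv {t : ℝ} (ht : t ≠ 0) :
    HasDerivAt quarticSinDeriv (quarticSinDeriv2 t) t := by
  refine ((((hasDerivAt_pow 3 t).const_mul 4).mul (hasDerivAt_one_div_sq ht).sin).sub
    (((hasDerivAt_id t).const_mul 2).mul (hasDerivAt_one_div_sq ht).cos)).congr_deriv ?_
  unfold quarticSinDeriv2
  simp only [id]
  field_simp
  push_cast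
  ring

lemma abs_quarticSin_le (t : ℝ) : |quarticSin t| ≤ |t| ^ 4 := by
  rw [quarticSin, abs_mul, abs_pow]
  exact mul_le_of_le_one_right (by positivity) (Real.abs_sin_le_one _)

lemma hasDerivAt_quarticSin (t : ℝ) : HasDerivAt quarticSin (quarticSinDeriv t) t := by
  rcases eq_or_ne t 0 with rfl | ht
  · have h : quarticSin =O[nhds 0] fun t => ‖t - 0‖ ^ 4 :=
      Asymptotics.IsBigO.of_norm_le fun t => by
        simpa using abs_quarticSin_le t
    have := (h.hasFDerivAt (by norm_num)).hasDerivAt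
    simpa [quarticSinDeriv] using this
  · exact hasDerivAt_quarticSin_of_ne ht

lemma abs_quarticSinDeriv_le (t : ℝ) : |quarticSinDeriv t| ≤ 4 * |t| ^ 3 + 2 * |t| := by
  refine (abs_sub _ _).trans (add_le_add ?_ ?_)
  · rw [abs_mul, abs_mul, abs_pow, abs_of_pos (by norm_num : (0 : ℝ) < 4)]
    exact mul_le_of_le_one_right (by positivity) (Real.abs_sin_le_one _)
  · rw [abs_mul, abs_mul, abs_of_pos (by norm_num : (0 : ℝ) < 2)]
    exact mul_le_of_le_one_right (by positivity) (Real.abs_cos_le_one _)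

lemma quarticSinDeriv_sub_isBigO (x : ℝ) :
    (fun t => quarticSinDeriv t - quarticSinDeriv x) =O[nhds x] fun t => t - x := by
  rcases eq_or_ne x 0 with rfl | hx
  · refine Asymptotics.IsBigO.of_bound 6 ?_
    filter_upwards [Metric.ball_mem_nhds (0 : ℝ) one_pos] with t ht
    have h1 : |t| ≤ 1 := by simpa using (mem_ball_zero_iff.1 ht).le
    have h0 : quarticSinDeriv 0 = 0 := by simp [quarticSinDeriv]
    rw [h0, sub_zero, sub_zero, Real.norm_eq_abs, Real.norm_eq_abs]
    refine (abs_quarticSinDeriv_le t).trans ?_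
    nlinarith [abs_nonneg t, mul_nonneg (abs_nonneg t) (sub_nonneg.2 (pow_le_one₀ (n := 2)
      (abs_nonneg t) h1))]
  · exact (hasDerivAt_quarticSinDeriv hx).hasFDerivAt.isBigO_sub

lemma continuous_quarticSinDeriv : Continuous quarticSinDeriv := by
  refine continuous_iff_continuousAt.2 fun x => ?_
  rw [ContinuousAt, ← tendsto_sub_nhds_zero_iff]
  refine (quarticSinDeriv_sub_isBigO x).trans_tendsto ?_
  exact tendsto_sub_nhds_zero_iff.2 tendsto_id

lemma contDiff_quarticSin : ContDiff ℝ 1 quarticSin := by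
  rw [contDiff_one_iff_deriv]
  refine ⟨fun t => (hasDerivAt_quarticSin t).differentiableAt, ?_⟩
  rw [show deriv quarticSin = quarticSinDeriv from
    funext fun t => (hasDerivAt_quarticSin t).deriv]
  exact continuous_quarticSinDeriv

lemma contDiff_whitneyExample : ContDiff ℝ 1 whitneyExample := by
  rw [show whitneyExample = fun z => quarticSin z.1 from funext whitneyExample_eq]
  exact contDiff_quarticSin.comp contDiff_fst

lemma fderiv_whitneyExample_apply (z v : ℝ × ℝ) :
    fderiv ℝ whitneyExample z v = quarticSinDeriv z.1 * v.1 := by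
  rw [show whitneyExample = quarticSin ∘ Prod.fst from funext whitneyExample_eq]
  rw [((hasDerivAt_quarticSin z.1).comp_hasFDerivAt z hasFDerivAt_fst).fderiv]
  simp

/-- If `g'` is `O(t - x)`-close to `g' x` near `x`, then `g` has a first-order Taylor expansion at
`x` with quadratic remainder. -/
lemma exists_taylor_remainder_le {g g' : ℝ → ℝ} (hg : ∀ t, HasDerivAt g (g' t) t) {x : ℝ}
    (hO : (fun t => g' t - g' x) =O[nhds x] fun t => t - x) :
    ∃ C ≥ 0, ∃ δ > 0, ∀ t, |t - x| < δ → |g t - g x - g' x * (t - x)| ≤ C * |t - x| ^ 2 := by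
  obtain ⟨C, hC, hb⟩ := hO.exists_nonneg
  obtain ⟨δ, hδ, hball⟩ := Metric.eventually_nhds_iff.1 hb.bound
  refine ⟨C, hC, δ, hδ, fun t ht => ?_⟩
  have key := Convex.norm_image_sub_le_of_norm_hasDerivWithin_le
    (f := fun s => g s - g' x * s) (f' := fun s => g' s - g' x)
    (s := closedBall x |t - x|) (C := C * |t - x|) (x := x) (y := t)
    (fun s _ => ((hg s).sub (((hasDerivAt_id s).const_mul (g' x)).congr_deriv
      (mul_one _))).hasDerivWithinAt)
    (fun s hs => by
      have hs' : dist s x ≤ |t - x| := hs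
      refine (hball (hs'.trans_lt ht)).trans ?_
      rw [Real.dist_eq] at hs'
      exact mul_le_mul_of_nonneg_left hs' hC)
    (convex_closedBall _ _) (mem_closedBall_self (abs_nonneg _)) (mem_closedBall.2 le_rfl)
  simp only [Real.norm_eq_abs] at key
  calc |g t - g x - g' x * (t - x)| = |g t - g' x * t - (g x - g' x * x)| := by ring_nf
    _ ≤ C * |t - x| * |t - x| := key
    _ = C * |t - x| ^ 2 := by ring

lemma apSmall2_of_inter_ball_eq_empty {z : ℝ × ℝ} {A : Set (ℝ × ℝ)} {δ : ℝ} (hδ : 0 < δ)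
    (h : A ∩ ball z δ = ∅) : apSmall2 z A := by
  refine tendsto_const_nhds.congr' ?_
  filter_upwards [Ioo_mem_nhdsGT hδ] with r hr
  have : A ∩ ball z r = ∅ :=
    subset_empty_iff.1 ((inter_subset_inter_right _ (ball_subset_ball hr.2.le)).trans h.subset)
  simp [this]

lemma exists_apSmall2_whitneyExample (z : ℝ × ℝ) : ∃ lam : ℝ, apSmall2 z {w | w ≠ z ∧
    lam * ‖w - z‖ ^ 2 ≤
      ‖whitneyExample w - whitneyExample z - fderiv ℝ whitneyExample z (w - z)‖} := by
  obtain ⟨C, hC, δ, hδ, h⟩ :=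
    exists_taylor_remainder_le hasDerivAt_quarticSin (quarticSinDeriv_sub_isBigO z.1)
  refine ⟨C + 1, apSmall2_of_inter_ball_eq_empty hδ ?_⟩
  refine eq_empty_of_forall_notMem fun w hw => ?_
  obtain ⟨⟨hne, hle⟩, hw⟩ := hw
  have h1 : |w.1 - z.1| ≤ ‖w - z‖ := norm_fst_le (w - z)
  have h2 : ‖w - z‖ < δ := mem_ball_iff_norm.1 hw
  have h3 : 0 < ‖w - z‖ := norm_pos_iff.2 (sub_ne_zero.2 hne)
  rw [whitneyExample_eq, whitneyExample_eq, fderiv_whitneyExample_apply, Prod.fst_sub,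
    Real.norm_eq_abs] at hle
  have h4 := hle.trans (h w.1 (h1.trans_lt h2))
  have h5 : C * |w.1 - z.1| ^ 2 ≤ C * ‖w - z‖ ^ 2 := by gcongr
  nlinarith [pow_pos h3 2]

lemma continuousOn_one_div_sq {a b : ℝ} (ha : 0 < a) :
    ContinuousOn (fun x : ℝ => 1 / x ^ 2) (Icc a b) := fun _ hx =>
  (hasDerivAt_one_div_sq (ha.trans_le hx.1).ne').continuousAt.continuousWithinAt

lemma le_integral_sin_sq_div_sq {a b : ℝ} (ha : 0 < a) (hab : a ≤ b) :
    2 / a - 2 / b - 2 * b ≤ ∫ x in a..b, 4 * Real.sin (1 / x ^ 2) ^ 2 * (1 / x ^ 2) := by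
  have hu := continuousOn_one_div_sq (b := b) ha
  have hs : ContinuousOn (fun x : ℝ => Real.sin (1 / x ^ 2)) (Icc a b) :=
    Real.continuous_sin.comp_continuousOn hu
  have hc : ContinuousOn (fun x : ℝ => Real.cos (1 / x ^ 2)) (Icc a b) :=
    Real.continuous_cos.comp_continuousOn hu
  have hp : IntervalIntegrable (fun x : ℝ => 4 * Real.sin (1 / x ^ 2) ^ 2 * (1 / x ^ 2))
      volume a b :=
    (((hs.pow 2).const_mul 4).mul hu).intervalIntegrable_of_Icc hab
  have hsc : IntervalIntegrable (fun x : ℝ => Real.sin (1 / x ^ 2) * Real.cos (1 / x ^ 2))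
      volume a b := (hs.mul hc).intervalIntegrable_of_Icc hab
  have hder : ∀ x ∈ uIcc a b, HasDerivAt
      (fun x : ℝ => -2 * x⁻¹ + x * (Real.sin (1 / x ^ 2) * Real.cos (1 / x ^ 2)))
      (4 * Real.sin (1 / x ^ 2) ^ 2 * (1 / x ^ 2) +
        Real.sin (1 / x ^ 2) * Real.cos (1 / x ^ 2)) x := by
    intro x hx
    rw [uIcc_of_le hab] at hx
    have hx0 : x ≠ 0 := (ha.trans_le hx.1).ne'
    have h := hasDerivAt_one_div_sq hx0
    refine (((hasDerivAt_inv hx0).const_mul (-2)).add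
      ((hasDerivAt_id x).mul (h.sin.mul h.cos))).congr_deriv ?_
    have hcs := Real.sin_sq_add_cos_sq (1 / x ^ 2)
    simp only [id, Pi.mul_apply]
    generalize Real.sin (1 / x ^ 2) = S at *
    generalize Real.cos (1 / x ^ 2) = K at *
    have hK : K ^ 2 = 1 - S ^ 2 := by linarith
    field_simp
    ring_nf
    rw [hK]
    ring
  have hftc := intervalIntegral.integral_eq_sub_of_hasDerivAt hder (hp.add hsc)
  have hle : ∫ x in a..b, (4 * Real.sin (1 / x ^ 2) ^ 2 * (1 / x ^ 2) +
        Real.sin (1 / x ^ 2) * Real.cos (1 / x ^ 2)) ≤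
      ∫ x in a..b, (4 * Real.sin (1 / x ^ 2) ^ 2 * (1 / x ^ 2) + 1) := by
    refine intervalIntegral.integral_mono_on hab (hp.add hsc)
      (hp.add intervalIntegrable_const) fun x _ => ?_
    nlinarith [Real.sin_sq_add_cos_sq (1 / x ^ 2),
      sq_nonneg (Real.sin (1 / x ^ 2) - Real.cos (1 / x ^ 2))]
  rw [hftc, intervalIntegral.integral_add hp intervalIntegrable_const,
    intervalIntegral.integral_const, smul_eq_mul, mul_one] at hle
  have hbd : ∀ u : ℝ, |Real.sin u * Real.cos u| ≤ 1 := fun u => by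
    rw [abs_mul]
    exact mul_le_one₀ (Real.abs_sin_le_one u) (abs_nonneg _) (Real.abs_cos_le_one u)
  have h1 := mul_le_mul_of_nonneg_left (abs_le.1 (hbd (1 / b ^ 2))).1 (ha.le.trans hab)
  have h2 := mul_le_mul_of_nonneg_left (abs_le.1 (hbd (1 / a ^ 2))).2 ha.le
  rw [div_eq_mul_inv, div_eq_mul_inv]
  linarith

/-- Integrating by parts twice against a test function supported away from the origin. -/
lemma integral_quarticSin_mul_deriv_deriv {ψ : ℝ → ℝ} (hψ : ContDiff ℝ 2 ψ) {a b : ℝ} (ha : 0 < a)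
    (hab : a ≤ b) (hsupp : tsupport ψ ⊆ Ioo a b) :
    ∫ x, quarticSin x * deriv (deriv ψ) x = ∫ x in a..b, quarticSinDeriv2 x * ψ x := by
  have hψ' : ContDiff ℝ 1 (deriv ψ) := by
    have : ContDiff ℝ (1 + 1) ψ := by simpa [one_add_one_eq_two] using hψ
    exact (contDiff_succ_iff_deriv.1 this).2.2
  have hsupp1 : Function.support (deriv ψ) ⊆ Ioo a b := (support_deriv_subset).trans hsupp
  have hsupp2 : Function.support (deriv (deriv ψ)) ⊆ Ioo a b :=
    (support_deriv_subset).trans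
      ((closure_minimal support_deriv_subset (isClosed_tsupport ψ)).trans hsupp)
  have hz : ∀ {h : ℝ → ℝ}, Function.support h ⊆ Ioo a b → h a = 0 ∧ h b = 0 := fun hs =>
    ⟨Function.notMem_support.1 fun hx => (hs hx).1.false,
      Function.notMem_support.1 fun hx => (hs hx).2.false⟩
  have hcont2 : ContinuousOn quarticSinDeriv2 (Icc a b) := by
    have hu := continuousOn_one_div_sq (b := b) ha
    have hs : ContinuousOn (fun x : ℝ => Real.sin (1 / x ^ 2)) (Icc a b) :=
      Real.continuous_sin.comp_continuousOn hu
    have hc : ContinuousOn (fun x : ℝ => Real.cos (1 / x ^ 2)) (Icc a b) :=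
      Real.continuous_cos.comp_continuousOn hu
    have h4 : ContinuousOn (fun x : ℝ => 4 / x ^ 2) (Icc a b) :=
      (hu.const_mul 4).congr fun x _ => by ring
    exact ((((continuous_pow 2).const_mul 12).continuousOn.mul hs).sub (hc.const_mul 10)).sub
      (h4.mul hs)
  have hi1 : IntervalIntegrable (fun x => quarticSin x * deriv (deriv ψ) x) volume a b :=
    (contDiff_quarticSin.continuous.mul
      (hψ'.continuous_deriv le_rfl)).intervalIntegrable _ _
  have hi2 : IntervalIntegrable (fun x => quarticSinDeriv2 x * ψ x) volume a b :=
    (hcont2.mul hψ.continuous.continuousOn).intervalIntegrable_of_Icc hab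
  have hder : ∀ x ∈ uIcc a b, HasDerivAt
      (fun x => quarticSin x * deriv ψ x - quarticSinDeriv x * ψ x)
      (quarticSin x * deriv (deriv ψ) x - quarticSinDeriv2 x * ψ x) x := by
    intro x hx
    rw [uIcc_of_le hab] at hx
    have hx0 : x ≠ 0 := (ha.trans_le hx.1).ne'
    refine (((hasDerivAt_quarticSin x).mul
      (hψ'.differentiable (by norm_num) x).hasDerivAt).sub
      ((hasDerivAt_quarticSinDeriv hx0).mul
        (hψ.differentiable (by norm_num) x).hasDerivAt)).congr_deriv ?_
    ring
  have hftc := intervalIntegral.integral_eq_sub_of_hasDerivAt hder (hi1.sub hi2)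
  have hψz := hz ((subset_tsupport ψ).trans hsupp)
  have hψ'z := hz hsupp1
  rw [intervalIntegral.integral_sub hi1 hi2, hψz.1, hψz.2, hψ'z.1, hψ'z.2] at hftc
  rw [← intervalIntegral.integral_eq_integral_of_support_subset (a := a) (b := b)]
  · linarith
  · exact (Function.support_mul_subset_right _ _).trans (hsupp2.trans Ioo_subset_Ioc_self)

/-- A test function on the line detecting the oscillation of `quarticSinDeriv2`. -/
lemma exists_oscillating_test {ε δ : ℝ} (hε : 0 < ε) (hεδ : 4 * ε < δ) (hδ : δ ≤ 1) :
    ∃ ψ : ℝ → ℝ, ContDiff ℝ (⊤ : ℕ∞) ψ ∧ Function.support ψ ⊆ Ioo ε δ ∧ (∀ x, |ψ x| ≤ 1) ∧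
      1 / ε - 4 / δ - 100 ≤ ∫ x, quarticSin x * deriv (deriv ψ) x := by
  let η : ContDiffBump ((ε + δ) / 2) :=
    ⟨(δ - 3 * ε) / 2, (δ - 2 * ε) / 2, by linarith, by linarith⟩
  let ψ : ℝ → ℝ := fun x => η x * -Real.sin (1 / x ^ 2)
  have htsupp : tsupport ψ ⊆ Ioo ε δ := by
    refine (tsupport_mul_subset_left (f := η)).trans ?_
    rw [η.tsupport_eq, Real.closedBall_eq_Icc]
    refine Icc_subset_Ioo ?_ ?_
    · change ε < (ε + δ) / 2 - (δ - 2 * ε) / 2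
      linarith
    · change (ε + δ) / 2 + (δ - 2 * ε) / 2 < δ
      linarith
  have hψ : ContDiff ℝ (⊤ : ℕ∞) ψ := by
    refine contDiff_iff_contDiffAt.2 fun x => ?_
    by_cases hx : x ∈ tsupport ψ
    swap
    · exact contDiffAt_const.congr_of_eventuallyEq (notMem_tsupport_iff_eventuallyEq.1 hx)
    have hx0 : x ≠ 0 := (hε.trans (htsupp hx).1).ne'
    have hu : ContDiffAt ℝ (⊤ : ℕ∞) (fun x : ℝ => 1 / x ^ 2) x :=
      contDiffAt_const.div (contDiffAt_id.pow 2) (pow_ne_zero 2 hx0)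
    exact η.contDiffAt.mul hu.sin.neg
  have hab : ε ≤ δ := by linarith
  refine ⟨ψ, hψ, (subset_tsupport ψ).trans htsupp, fun x => ?_, ?_⟩
  · rw [abs_mul, abs_neg, abs_of_nonneg η.nonneg]
    exact mul_le_one₀ η.le_one (abs_nonneg _) (Real.abs_sin_le_one _)
  have hu := continuousOn_one_div_sq (b := δ) hε
  have hs : ContinuousOn (fun x : ℝ => Real.sin (1 / x ^ 2)) (Icc ε δ) :=
    Real.continuous_sin.comp_continuousOn hu
  have hc : ContinuousOn (fun x : ℝ => Real.cos (1 / x ^ 2)) (Icc ε δ) :=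
    Real.continuous_cos.comp_continuousOn hu
  let p : ℝ → ℝ := fun x => 4 * Real.sin (1 / x ^ 2) ^ 2 * (1 / x ^ 2)
  have hηp : IntervalIntegrable (fun x => η x * p x) volume ε δ :=
    (η.continuous.continuousOn.mul
      (((hs.pow 2).const_mul 4).mul hu)).intervalIntegrable_of_Icc hab
  have hp0 : ∀ x, 0 ≤ p x := fun x => by positivity
  rw [integral_quarticSin_mul_deriv_deriv (contDiff_infty.1 hψ 2) hε hab htsupp]
  have hgψ : IntervalIntegrable (fun x => quarticSinDeriv2 x * ψ x) volume ε δ := by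
    have : ContinuousOn (fun x => (12 * x ^ 2 * Real.sin (1 / x ^ 2) -
        10 * Real.cos (1 / x ^ 2) - 4 * (1 / x ^ 2) * Real.sin (1 / x ^ 2)) * ψ x) (Icc ε δ) :=
      (((((continuous_pow 2).const_mul 12).continuousOn.mul hs).sub (hc.const_mul 10)).sub
        ((hu.const_mul 4).mul hs)).mul hψ.continuous.continuousOn
    refine (this.congr fun x _ => ?_).intervalIntegrable_of_Icc hab
    simp only [quarticSinDeriv2]
    ring
  have hmono : ∫ x in ε..δ, (η x * p x - 22) ≤ ∫ x in ε..δ, quarticSinDeriv2 x * ψ x := by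
    refine intervalIntegral.integral_mono_on hab (hηp.sub intervalIntegrable_const) hgψ
      fun x hx => ?_
    have hx0 : 0 < x := hε.trans_le hx.1
    have hx2 : x ^ 2 ≤ 1 := pow_le_one₀ hx0.le (hx.2.trans hδ)
    have hη0 := η.nonneg (x := x)
    have hη1 := η.le_one (x := x)
    have hS := Real.sin_sq_add_cos_sq (1 / x ^ 2)
    have hid : quarticSinDeriv2 x * ψ x = η x * p x - η x * (12 * (x ^ 2 * Real.sin (1 / x ^ 2) ^ 2)
        - 10 * (Real.sin (1 / x ^ 2) * Real.cos (1 / x ^ 2))) := by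
      simp only [quarticSinDeriv2, ψ, p]
      ring
    rw [hid]
    generalize Real.sin (1 / x ^ 2) = S at *
    generalize Real.cos (1 / x ^ 2) = K at *
    have h1 : x ^ 2 * S ^ 2 ≤ 1 :=
      mul_le_one₀ hx2 (sq_nonneg _) (by nlinarith [sq_nonneg K])
    have h2 : -1 ≤ S * K := by nlinarith [sq_nonneg (S + K)]
    have h3 : 12 * (x ^ 2 * S ^ 2) - 10 * (S * K) ≤ 22 := by linarith
    nlinarith [mul_le_mul_of_nonneg_left h3 hη0]
  rw [intervalIntegral.integral_sub hηp intervalIntegrable_const,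
    intervalIntegral.integral_const, smul_eq_mul] at hmono
  have hsub : ∫ x in (2 * ε)..(δ - ε), η x * p x ≤ ∫ x in ε..δ, η x * p x :=
    intervalIntegral.integral_mono_interval (by linarith) (by linarith) (by linarith)
      (Eventually.of_forall fun x => mul_nonneg η.nonneg (hp0 x)) hηp
  have hone : ∫ x in (2 * ε)..(δ - ε), η x * p x = ∫ x in (2 * ε)..(δ - ε), p x := by
    refine intervalIntegral.integral_congr fun x hx => ?_
    rw [uIcc_of_le (by linarith)] at hx
    have : η x = 1 := η.one_of_mem_closedBall (by
      rw [Real.closedBall_eq_Icc]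
      change x ∈ Icc ((ε + δ) / 2 - (δ - 3 * ε) / 2) ((ε + δ) / 2 + (δ - 3 * ε) / 2)
      exact ⟨by linarith [hx.1], by linarith [hx.2]⟩)
    simp [this]
  have hlow := le_integral_sin_sq_div_sq (a := 2 * ε) (b := δ - ε) (by linarith) (by linarith)
  have h1 : 2 / (2 * ε) = 1 / ε := by field_simp
  have h2 : 2 / (δ - ε) ≤ 4 / δ := by
    rw [div_le_div_iff₀ (by linarith) (by linarith)]
    linarith
  have h3 : ∫ x in (2 * ε)..(δ - ε), p x =
    ∫ x in (2 * ε)..(δ - ε), 4 * Real.sin (1 / x ^ 2) ^ 2 * (1 / x ^ 2) := rfl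
  linarith

lemma fderiv_mul_fst_snd_apply {a b : ℝ → ℝ} (ha : Differentiable ℝ a) (hb : Differentiable ℝ b)
    (z : ℝ × ℝ) : fderiv ℝ (fun z : ℝ × ℝ => a z.1 * b z.2) z (1, 0) = deriv a z.1 * b z.2 := by
  have h1 := (ha z.1).hasDerivAt.comp_hasFDerivAt z (hasFDerivAt_fst (𝕜 := ℝ))
  have h2 := (hb z.2).hasDerivAt.comp_hasFDerivAt z (hasFDerivAt_snd (𝕜 := ℝ))
  have h3 : fderiv ℝ (fun z : ℝ × ℝ => a z.1 * b z.2) z = _ := (h1.mul h2).fderiv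
  rw [h3]
  simp [mul_comm]

lemma iteratedFDeriv_two_mul_fst_snd {a b : ℝ → ℝ} (ha : ContDiff ℝ 2 a) (hb : ContDiff ℝ 2 b)
    (z : ℝ × ℝ) : iteratedFDeriv ℝ 2 (fun z : ℝ × ℝ => a z.1 * b z.2) z
      ![((1 : ℝ), (0 : ℝ)), (1, 0)] = deriv (deriv a) z.1 * b z.2 := by
  have ha' : Differentiable ℝ a := ha.differentiable (by norm_num)
  have hb' : Differentiable ℝ b := hb.differentiable (by norm_num)
  have hda : Differentiable ℝ (deriv a) := by
    have : ContDiff ℝ (1 + 1) a := by simpa [one_add_one_eq_two] using ha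
    exact (contDiff_succ_iff_deriv.1 this).2.2.differentiable (by norm_num)
  have hφ : ContDiff ℝ 2 (fun z : ℝ × ℝ => a z.1 * b z.2) :=
    (ha.comp contDiff_fst).mul (hb.comp contDiff_snd)
  have hdφ : Differentiable ℝ (fderiv ℝ (fun z : ℝ × ℝ => a z.1 * b z.2)) :=
    (hφ.fderiv_right (m := 1) (by norm_num [one_add_one_eq_two])).differentiable (by norm_num)
  rw [iteratedFDeriv_two_apply]
  simp only [Matrix.cons_val_zero, Matrix.cons_val_one]
  have h : fderiv ℝ (fun w => fderiv ℝ (fun z : ℝ × ℝ => a z.1 * b z.2) w (1, 0)) z (1, 0) =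
      fderiv ℝ (fderiv ℝ (fun z : ℝ × ℝ => a z.1 * b z.2)) z (1, 0) (1, 0) := by
    rw [fderiv_clm_apply (hdφ z) (differentiableAt_const _)]
    simp
  rw [← h]
  simp only [fderiv_mul_fst_snd_apply ha' hb']
  exact fderiv_mul_fst_snd_apply hda hb' z

lemma not_exists_finite_measure_secondDeriv (U : Set (ℝ × ℝ)) (hU : IsOpen U) (h0 : (0, 0) ∈ U) :
    ¬ ∃ μ ν : Measure (ℝ × ℝ), IsFiniteMeasure μ ∧ IsFiniteMeasure ν ∧
      ∀ φ : ℝ × ℝ → ℝ, ContDiff ℝ (⊤ : ℕ∞) φ → HasCompactSupport φ → tsupport φ ⊆ U →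
        ∫ z, whitneyExample z * iteratedFDeriv ℝ 2 φ z ![((1:ℝ), (0:ℝ)), (1, 0)] =
          (∫ z, φ z ∂μ) - ∫ z, φ z ∂ν := by
  rintro ⟨μ, ν, hμ, hν, H⟩
  obtain ⟨δ', hδ', hsub'⟩ := Metric.nhds_basis_closedBall.mem_iff.1 (hU.mem_nhds h0)
  obtain ⟨δ, hδ, hδ1, hsub⟩ : ∃ δ > 0, δ ≤ 1 ∧ closedBall ((0 : ℝ), (0 : ℝ)) δ ⊆ U :=
    ⟨min δ' 1, by positivity, min_le_right _ _,
      (closedBall_subset_closedBall (min_le_left _ _)).trans hsub'⟩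
  let χ : ContDiffBump (0 : ℝ) := ⟨δ / 2, δ, by positivity, by linarith⟩
  set c : ℝ := ∫ y, χ y with hc
  have hcpos : 0 < c := χ.integral_pos
  have bound : ∀ ε, 0 < ε → 4 * ε < δ →
      (1 / ε - 4 / δ - 100) * c ≤ μ.real univ + ν.real univ := by
    intro ε hε hεδ
    obtain ⟨ψ, hψ, hsupp, hψ1, hint⟩ := exists_oscillating_test hε hεδ hδ1
    have hψ2 : ContDiff ℝ 2 ψ := contDiff_infty.1 hψ 2
    have hsφ : tsupport (fun z : ℝ × ℝ => ψ z.1 * χ z.2) ⊆ closedBall ((0 : ℝ), (0 : ℝ)) δ := by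
      refine closure_minimal (fun z hz => ?_) isClosed_closedBall
      have hz1 : ψ z.1 ≠ 0 := left_ne_zero_of_mul hz
      have hz2 : χ z.2 ≠ 0 := right_ne_zero_of_mul hz
      have h1 := hsupp hz1
      have h2 : z.2 ∈ ball (0 : ℝ) δ := χ.support_eq ▸ (Function.mem_support.2 hz2)
      rw [← closedBall_prod_same]
      refine ⟨?_, ball_subset_closedBall h2⟩
      rw [mem_closedBall_zero_iff, Real.norm_eq_abs, abs_of_pos (hε.trans h1.1)]
      exact h1.2.le
    have hφ1 : ∀ z : ℝ × ℝ, ‖ψ z.1 * χ z.2‖ ≤ 1 := fun z => by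
      rw [norm_mul, Real.norm_eq_abs, Real.norm_eq_abs, abs_of_nonneg χ.nonneg]
      exact mul_le_one₀ (hψ1 _) χ.nonneg χ.le_one
    have key := H (fun z => ψ z.1 * χ z.2)
      ((hψ.comp contDiff_fst).mul (χ.contDiff.comp contDiff_snd))
      ((isCompact_closedBall _ _).of_isClosed_subset (isClosed_tsupport _) hsφ)
      (hsφ.trans hsub)
    have hL : ∫ z, whitneyExample z * iteratedFDeriv ℝ 2 (fun z : ℝ × ℝ => ψ z.1 * χ z.2) z
        ![((1:ℝ), (0:ℝ)), (1, 0)] = (∫ x, quarticSin x * deriv (deriv ψ) x) * c := by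
      rw [hc, ← integral_prod_mul, ← Measure.volume_eq_prod]
      refine integral_congr_ae (Eventually.of_forall fun z => ?_)
      simp only [whitneyExample_eq, iteratedFDeriv_two_mul_fst_snd hψ2 χ.contDiff, mul_assoc]
    have hμ1 := norm_integral_le_of_norm_le_const (μ := μ) (Eventually.of_forall hφ1)
    have hν1 := norm_integral_le_of_norm_le_const (μ := ν) (Eventually.of_forall hφ1)
    rw [Real.norm_eq_abs, one_mul] at hμ1 hν1
    calc (1 / ε - 4 / δ - 100) * c ≤ (∫ x, quarticSin x * deriv (deriv ψ) x) * c := by gcongr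
      _ = _ := hL.symm.trans key
      _ ≤ _ := by linarith [(abs_le.1 hμ1).2, (abs_le.1 hν1).1]
  have hlim : Tendsto (fun ε : ℝ => (1 / ε - 4 / δ - 100) * c) (nhdsWithin 0 (Ioi 0)) atTop := by
    refine Tendsto.atTop_mul_const hcpos ?_
    simp only [one_div, sub_eq_add_neg]
    exact tendsto_atTop_add_const_right _ _
      (tendsto_atTop_add_const_right _ _ tendsto_inv_nhdsGT_zero)
  obtain ⟨ε, h1, h2⟩ := ((hlim.eventually_gt_atTop (μ.real univ + ν.real univ)).and
    (Ioo_mem_nhdsGT (by positivity : 0 < δ / 4))).exists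
  exact absurd (bound ε h2.1 (by linarith [h2.2])) (not_le.2 h1)

/-- `f(x,y) = x⁴ sin(1/x²)` (extended by `0` at `x = 0`) is of class `C¹`,
is locally Lipschitz, has an approximate first-order Taylor expansion with finite
second-order ap-limsup at every point of `ℝ²`, but its distributional second derivative
`∂²f/∂x²` is not a finite (signed) Radon measure on any neighborhood of the line `x = 0`,
so `f ∉ BV₂`. -/
theorem whitneyExample_properties :
    ContDiff ℝ 1 whitneyExample ∧
    LocallyLipschitz whitneyExample ∧
    (∀ z : ℝ × ℝ, ∃ lam : ℝ, apSmall2 z {w | w ≠ z ∧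
      lam * ‖w - z‖ ^ 2 ≤
        ‖whitneyExample w - whitneyExample z - fderiv ℝ whitneyExample z (w - z)‖}) ∧
    (∀ U : Set (ℝ × ℝ), IsOpen U → {q : ℝ × ℝ | q.1 = 0} ⊆ U →
      ¬ ∃ μ ν : Measure (ℝ × ℝ), IsFiniteMeasure μ ∧ IsFiniteMeasure ν ∧
        ∀ φ : ℝ × ℝ → ℝ, ContDiff ℝ (⊤ : ℕ∞) φ → HasCompactSupport φ → tsupport φ ⊆ U →
          ∫ z, whitneyExample z * iteratedFDeriv ℝ 2 φ z ![((1:ℝ), (0:ℝ)), (1, 0)] =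
            (∫ z, φ z ∂μ) - ∫ z, φ z ∂ν) := by
  refine ⟨contDiff_whitneyExample, contDiff_whitneyExample.locallyLipschitz,
    exists_apSmall2_whitneyExample, fun U hU hsub => ?_⟩
  exact not_exists_finite_measure_secondDeriv U hU (hsub rfl)

end
end

section
/- (Uniform Whitney extension, arbitrary sets) Let ω be a modulus of continuity, C ⊆ ℝⁿ an arbitrary (not necessarily closed) set, and {f_α}_{|α|≤k} real-valued functions on C satisfying f_α(x) = Σ_{|β|≤k-|α|} f_{α+β}(y)/β! (x-y)^β + R_α(x,y) with |f_α(x)| ≤ M and |R_α(x,y)| ≤ M|x-y|^{k-|α|} ω(|x-y|) for all x,y ∈ C and |α| ≤ k. Then there exists F ∈ C^{k,ω}(ℝⁿ;ℝ) with D^α F = f_α on C for all |α| ≤ k. -/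
open MeasureTheory Metric Filter Set

noncomputable section

/-- `ℝⁿ` as a Euclidean space. -/
abbrev Ec (n : ℕ) := EuclideanSpace ℝ (Fin n)

/-- The order `|α|` of a multi-index `α`. -/
def mdeg {n : ℕ} (α : Fin n →₀ ℕ) : ℕ := α.sum fun _ m => m

/-- The factorial `α!` of a multi-index. -/
def mfact {n : ℕ} (α : Fin n →₀ ℕ) : ℝ := α.prod fun _ m => (m.factorial : ℝ)

/-- The monomial `v^α = ∏ᵢ vᵢ^{αᵢ}`. -/
def mpow {n : ℕ} (α : Fin n →₀ ℕ) (v : Ec n) : ℝ := α.prod fun i m => (v i) ^ m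

/-- The partial derivative `∂F/∂xᵢ`. -/
def pder {n : ℕ} (i : Fin n) (F : Ec n → ℝ) : Ec n → ℝ :=
  fun x => fderiv ℝ F x (EuclideanSpace.single i 1)

/-- The iterated partial derivative `D^α F`. -/
def pderMulti {n : ℕ} (α : Fin n →₀ ℕ) (F : Ec n → ℝ) : Ec n → ℝ :=
  (α.support.sort (· ≤ ·)).foldr (fun i G => (pder i)^[α i] G) F

/-- The finset of multi-indices `β` with `|β| ≤ d`. -/
def multiIdxLe (n d : ℕ) : Finset (Fin n →₀ ℕ) :=
  (Finset.Iic (Finsupp.equivFunOnFinite.symm fun _ : Fin n => d)).filter fun β => mdeg β ≤ d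

/-- The properties required of a modulus of continuity `ω : [0, ∞) → [0, ∞)`. -/
structure IsModulus (ω : ℝ → ℝ) : Prop where
  nonneg : ∀ s, 0 ≤ s → 0 ≤ ω s
  mono : ∀ a b, 0 ≤ a → a ≤ b → ω a ≤ ω b
  concave : ConcaveOn ℝ (Ici (0 : ℝ)) ω
  tendsto_zero : Tendsto ω (nhdsWithin 0 (Ioi 0)) (nhds 0)

namespace IsModulus

variable {ω : ℝ → ℝ}

lemma map_zero (hω : IsModulus ω) : ω 0 = 0 := by
  refine le_antisymm (ge_of_tendsto hω.tendsto_zero ?_) (hω.nonneg 0 le_rfl)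
  filter_upwards [self_mem_nhdsWithin] with s hs using hω.mono 0 s le_rfl (le_of_lt hs)

lemma continuousOn (hω : IsModulus ω) : ContinuousOn ω (Ici 0) := by
  intro s hs
  rcases eq_or_lt_of_le (mem_Ici.1 hs) with rfl | hs
  · rw [← continuousWithinAt_Ioi_iff_Ici, ContinuousWithinAt, hω.map_zero]
    exact hω.tendsto_zero
  · have h := (hω.concave.continuousOn_interior s (by simpa using hs))
    rw [interior_Ici] at h
    exact (h.continuousAt (Ioi_mem_nhds hs)).continuousWithinAt

lemma continuous_comp {X : Type*} [TopologicalSpace X] (hω : IsModulus ω) {g : X → ℝ}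
    (hg : Continuous g) (h0 : ∀ x, 0 ≤ g x) : Continuous fun x => ω (g x) :=
  hω.continuousOn.comp_continuous hg h0

lemma map_mul_le (hω : IsModulus ω) {c s : ℝ} (hc : 1 ≤ c) (hs : 0 ≤ s) :
    ω (c * s) ≤ c * ω s := by
  have hc0 : 0 < c := by linarith
  have hcs : c * s ∈ Ici (0 : ℝ) := mem_Ici.2 (by positivity)
  have h := hω.concave.2 hcs (mem_Ici.2 le_rfl) (inv_nonneg.2 hc0.le)
    (sub_nonneg.2 (inv_le_one_of_one_le₀ hc)) (add_sub_cancel c⁻¹ 1)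
  simp only [smul_eq_mul, mul_zero, add_zero, hω.map_zero] at h
  rw [inv_mul_cancel_left₀ hc0.ne'] at h
  calc ω (c * s) = c * (c⁻¹ * ω (c * s)) := by field_simp
    _ ≤ c * ω s := by gcongr

lemma mul_le_mul (hω : IsModulus ω) {s t : ℝ} (hs : 0 < s) (hst : s ≤ t) :
    s * ω t ≤ t * ω s := by
  have h := hω.map_mul_le (c := t / s) (s := s) ((one_le_div hs).2 hst) hs.le
  rw [div_mul_cancel₀ _ hs.ne'] at h
  calc s * ω t ≤ s * (t / s * ω s) := by gcongr
    _ = t * ω s := by field_simp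

lemma map_le_mul (hω : IsModulus ω) {c s t : ℝ} (hc : 1 ≤ c) (hs : 0 ≤ s) (ht : 0 ≤ t)
    (h : t ≤ c * s) : ω t ≤ c * ω s :=
  (hω.mono _ _ ht h).trans (hω.map_mul_le hc hs)

end IsModulus

lemma continuous_mpow {n : ℕ} (β : Fin n →₀ ℕ) : Continuous (mpow β : Ec n → ℝ) := by
  unfold mpow Finsupp.prod
  fun_prop

/-- Every point of `closure C` carries an ultrafilter on `C` converging to it, which is principal
when the point lies in `C`. -/
lemma exists_ultrafilter_of_mem_closure {X : Type*} [TopologicalSpace X] {C : Set X} {x : X}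
    (hx : x ∈ closure C) :
    ∃ U : Ultrafilter X, (U : Filter X) ≤ nhds x ∧ C ∈ U ∧ (x ∈ C → U = pure x) := by
  by_cases hxC : x ∈ C
  · exact ⟨pure x, by simpa using pure_le_nhds x, by simpa using hxC, fun _ => rfl⟩
  · obtain ⟨U, hU, hUx⟩ := mem_closure_iff_ultrafilter.1 hx
    exact ⟨U, hUx, hU, fun h => absurd h hxC⟩

/-- A Whitney jet on an arbitrary set extends to the closure with the same estimates. -/
lemma exists_jet_closure {n k : ℕ} {ω : ℝ → ℝ} (hω : IsModulus ω) (C : Set (Ec n))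
    (f : (Fin n →₀ ℕ) → Ec n → ℝ) (M : ℝ)
    (hbound : ∀ α : Fin n →₀ ℕ, mdeg α ≤ k → ∀ x ∈ C, |f α x| ≤ M)
    (hjet : ∀ α : Fin n →₀ ℕ, mdeg α ≤ k → ∀ x ∈ C, ∀ y ∈ C,
      |f α x - ∑ β ∈ multiIdxLe n (k - mdeg α), f (α + β) y / mfact β * mpow β (x - y)| ≤
        M * ‖x - y‖ ^ (k - mdeg α) * ω ‖x - y‖) :
    ∃ g : (Fin n →₀ ℕ) → Ec n → ℝ, (∀ α, mdeg α ≤ k → ∀ x ∈ C, g α x = f α x) ∧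
      ∀ α : Fin n →₀ ℕ, mdeg α ≤ k → ∀ x ∈ closure C, ∀ y ∈ closure C,
      |g α x - ∑ β ∈ multiIdxLe n (k - mdeg α), g (α + β) y / mfact β * mpow β (x - y)| ≤
        M * ‖x - y‖ ^ (k - mdeg α) * ω ‖x - y‖ := by
  have hU : ∀ x : Ec n, ∃ U : Ultrafilter (Ec n), x ∈ closure C →
      (U : Filter (Ec n)) ≤ nhds x ∧ C ∈ U ∧ (x ∈ C → U = pure x) := by
    intro x
    by_cases hx : x ∈ closure C
    · obtain ⟨U, h⟩ := exists_ultrafilter_of_mem_closure hx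
      exact ⟨U, fun _ => h⟩
    · exact ⟨pure x, fun h => absurd h hx⟩
  choose U hU using hU
  have hg : ∀ (α : Fin n →₀ ℕ) (x : Ec n), ∃ v : ℝ, mdeg α ≤ k → x ∈ closure C →
      Tendsto (f α) (U x) (nhds v) := by
    intro α x
    by_cases h : mdeg α ≤ k ∧ x ∈ closure C
    · obtain ⟨v, -, hv⟩ := (isCompact_Icc (a := -M) (b := M)).ultrafilter_le_nhds
        ((U x).map (f α)) (by
          rw [le_principal_iff, Ultrafilter.mem_coe, Ultrafilter.mem_map]
          exact mem_of_superset (hU x h.2).2.1 fun y hy => abs_le.1 (hbound α h.1 y hy))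
      exact ⟨v, fun _ _ => hv⟩
    · exact ⟨0, fun h1 h2 => absurd ⟨h1, h2⟩ h⟩
  choose g hg using hg
  have hdeg : ∀ α β : Fin n →₀ ℕ, mdeg α ≤ k → β ∈ multiIdxLe n (k - mdeg α) →
      mdeg (α + β) ≤ k := by
    intro α β hα hβ
    have : mdeg (α + β) = mdeg α + mdeg β :=
      Finsupp.sum_add_index' (fun _ => rfl) (fun _ _ _ => rfl)
    have h2 : mdeg β ≤ k - mdeg α := (Finset.mem_filter.1 hβ).2
    omega
  have hright : ∀ α : Fin n →₀ ℕ, mdeg α ≤ k → ∀ x ∈ closure C, ∀ y ∈ C,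
      |g α x - ∑ β ∈ multiIdxLe n (k - mdeg α), f (α + β) y / mfact β * mpow β (x - y)| ≤
        M * ‖x - y‖ ^ (k - mdeg α) * ω ‖x - y‖ := by
    intro α hα x hx y hy
    have hc1 : Continuous fun z : Ec n =>
        ∑ β ∈ multiIdxLe n (k - mdeg α), f (α + β) y / mfact β * mpow β (z - y) := by
      refine continuous_finsetSum _ fun β _ => continuous_const.mul ?_
      exact (continuous_mpow β).comp (continuous_id.sub continuous_const)
    have hc2 : Continuous fun z : Ec n => M * ‖z - y‖ ^ (k - mdeg α) * ω ‖z - y‖ :=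
      (by fun_prop : Continuous fun z : Ec n => M * ‖z - y‖ ^ (k - mdeg α)).mul
        (hω.continuous_comp (by fun_prop) fun _ => norm_nonneg _)
    refine le_of_tendsto_of_tendsto
      (((hg α x hα hx).sub ((hc1.tendsto x).mono_left (hU x hx).1)).abs)
      ((hc2.tendsto x).mono_left (hU x hx).1) ?_
    filter_upwards [(hU x hx).2.1] with z hz using hjet α hα z hz y hy
  refine ⟨g, fun α hα x hx => ?_, fun α hα x hx y hy => ?_⟩
  · have h := hg α x hα (subset_closure hx)
    rw [(hU x (subset_closure hx)).2.2 hx] at h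
    exact (tendsto_nhds_unique (tendsto_pure_nhds (f α) x) h).symm
  · have hc2 : Continuous fun z : Ec n => M * ‖x - z‖ ^ (k - mdeg α) * ω ‖x - z‖ :=
      (by fun_prop : Continuous fun z : Ec n => M * ‖x - z‖ ^ (k - mdeg α)).mul
        (hω.continuous_comp (by fun_prop) fun _ => norm_nonneg _)
    refine le_of_tendsto_of_tendsto (Tendsto.abs (tendsto_const_nhds.sub
      (tendsto_finsetSum _ fun β hβ => ((hg (α + β) y (hdeg α β hα hβ) hy).div_const _).mul
        ((((continuous_mpow β).comp (continuous_const.sub continuous_id)).tendsto y).mono_left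
          (hU y hy).1)))) ((hc2.tendsto y).mono_left (hU y hy).1) ?_
    filter_upwards [(hU y hy).2.1] with z hz using hright α hα x hx z hz

section MultiIndex

variable {n : ℕ}

lemma mdeg_eq_sum (α : Fin n →₀ ℕ) : mdeg α = ∑ i, α i :=
  Finsupp.sum_fintype _ _ fun _ => rfl

lemma mdeg_add (α β : Fin n →₀ ℕ) : mdeg (α + β) = mdeg α + mdeg β := by
  simp [mdeg_eq_sum, Finset.sum_add_distrib]

lemma mdeg_single (i : Fin n) : mdeg (Finsupp.single i 1) = 1 := by
  simp [mdeg]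

lemma mdeg_sum_single {ι : Type*} (s : Finset ι) (c : ι → Fin n) :
    mdeg (∑ l ∈ s, Finsupp.single (c l) 1) = s.card := by
  classical
  induction s using Finset.induction_on with
  | empty => simp [mdeg]
  | insert a s ha ih => rw [Finset.sum_insert ha, mdeg_add, mdeg_single, ih,
      Finset.card_insert_of_notMem ha, add_comm]

lemma mem_multiIdxLe {d : ℕ} {β : Fin n →₀ ℕ} : β ∈ multiIdxLe n d ↔ mdeg β ≤ d := by
  refine ⟨fun h => (Finset.mem_filter.1 h).2, fun h => Finset.mem_filter.2 ⟨?_, h⟩⟩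
  rw [Finset.mem_Iic]
  intro i
  rw [mdeg_eq_sum] at h
  exact (Finset.single_le_sum (f := fun i => β i) (fun _ _ => Nat.zero_le _)
    (Finset.mem_univ i)).trans h

lemma mfact_eq_prod (α : Fin n →₀ ℕ) : mfact α = ∏ i, ((α i).factorial : ℝ) :=
  Finsupp.prod_fintype _ _ fun _ => by simp

lemma mpow_eq_prod (α : Fin n →₀ ℕ) (v : Ec n) : mpow α v = ∏ i, v i ^ α i :=
  Finsupp.prod_fintype _ _ fun _ => by simp

lemma mfact_ne_zero (α : Fin n →₀ ℕ) : mfact α ≠ 0 := by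
  rw [mfact_eq_prod]
  exact Finset.prod_ne_zero_iff.2 fun i _ => by positivity

lemma mfact_add_single (α : Fin n →₀ ℕ) (i : Fin n) :
    mfact (α + Finsupp.single i 1) = (α i + 1) * mfact α := by
  classical
  rw [mfact_eq_prod, mfact_eq_prod, ← Finset.mul_prod_erase _ _ (Finset.mem_univ i),
    ← Finset.mul_prod_erase _ (fun i => ((α i).factorial : ℝ)) (Finset.mem_univ i), ← mul_assoc]
  congr 1
  · simp [Nat.factorial_succ]
  · refine Finset.prod_congr rfl fun j hj => ?_
    simp [Finsupp.single_eq_of_ne (Finset.ne_of_mem_erase hj)]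

lemma mpow_zero_right {α : Fin n →₀ ℕ} (hα : α ≠ 0) : mpow α (0 : Ec n) = 0 := by
  obtain ⟨i, hi⟩ := Finsupp.ne_iff.1 hα
  rw [mpow_eq_prod]
  exact Finset.prod_eq_zero (Finset.mem_univ i) (by simpa using hi)

lemma hasFDerivAt_mpow (β : Fin n →₀ ℕ) (x : Ec n) :
    HasFDerivAt (mpow β) (∑ i, ((β i : ℝ) * mpow (β - Finsupp.single i 1) x) •
      (EuclideanSpace.proj i : Ec n →L[ℝ] ℝ)) x := by
  classical
  have h : HasFDerivAt (fun v : Ec n => ∏ i, v i ^ β i) _ x :=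
    HasFDerivAt.finsetProd (u := Finset.univ) fun i _ =>
      ((EuclideanSpace.proj i : Ec n →L[ℝ] ℝ).hasFDerivAt (x := x)).pow (β i)
  rw [show mpow β = fun v : Ec n => ∏ i, v i ^ β i from funext (mpow_eq_prod β)]
  refine h.congr_fderiv (Finset.sum_congr rfl fun i _ => ?_)
  have hprod : ∏ j ∈ Finset.univ.erase i, x j ^ (β - Finsupp.single i 1 : Fin n →₀ ℕ) j =
      ∏ j ∈ Finset.univ.erase i, x j ^ β j := Finset.prod_congr rfl fun j hj => by
    simp [Finsupp.single_eq_of_ne (Finset.ne_of_mem_erase hj)]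
  rw [mpow_eq_prod, ← Finset.mul_prod_erase _ _ (Finset.mem_univ i), hprod, smul_smul]
  congr 1
  simp
  ring

end MultiIndex

section DerivFamily

variable {n : ℕ}

/-- A family of functions indexed by multi-indices in which `T (α + eᵢ)` is the `i`-th partial
derivative of `T α`. -/
def IsDerivFamily (T : (Fin n →₀ ℕ) → Ec n → ℝ) : Prop :=
  ∀ α x, HasFDerivAt (T α) (∑ i, T (α + Finsupp.single i 1) x •
    (EuclideanSpace.proj i : Ec n →L[ℝ] ℝ)) x

namespace IsDerivFamily

variable {T : (Fin n →₀ ℕ) → Ec n → ℝ}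

lemma contDiff_nat (hT : IsDerivFamily T) (m : ℕ) : ∀ α, ContDiff ℝ m (T α) := by
  induction m with
  | zero =>
    intro α
    exact contDiff_zero.2 (continuous_iff_continuousAt.2 fun x => (hT α x).continuousAt)
  | succ m ih =>
    intro α
    rw [show ((m + 1 : ℕ) : WithTop ℕ∞) = (m : WithTop ℕ∞) + 1 by simp, contDiff_succ_iff_fderiv]
    refine ⟨fun x => (hT α x).differentiableAt, by simp, ?_⟩
    rw [show fderiv ℝ (T α) = fun x => ∑ i, T (α + Finsupp.single i 1) x •
      (EuclideanSpace.proj i : Ec n →L[ℝ] ℝ) from funext fun x => (hT α x).fderiv]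
    exact ContDiff.sum fun i _ => (ih _).smul contDiff_const

lemma contDiff (hT : IsDerivFamily T) (α : Fin n →₀ ℕ) :
    ContDiff ℝ ((⊤ : ℕ∞) : WithTop ℕ∞) (T α) :=
  contDiff_infty.2 fun m => hT.contDiff_nat m α

lemma pder_eq (hT : IsDerivFamily T) (α : Fin n →₀ ℕ) (i : Fin n) :
    pder i (T α) = T (α + Finsupp.single i 1) := by
  funext x
  rw [pder, (hT α x).fderiv, sum_apply,
    Finset.sum_eq_single i (fun j _ hj => by simp [hj]) (by simp)]
  simp

end IsDerivFamily

lemma iteratedFDeriv_succ_apply_fderiv {E : Type*} [NormedAddCommGroup E] [NormedSpace ℝ E]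
    {F : E → ℝ} {k j : ℕ} (hF : ContDiff ℝ k F) (hj : j < k) (x : E) (m : Fin (j + 1) → E) :
    iteratedFDeriv ℝ (j + 1) F x m =
      fderiv ℝ (fun y => iteratedFDeriv ℝ j F y (Fin.tail m)) x (m 0) := by
  have hd : DifferentiableAt ℝ (iteratedFDeriv ℝ j F) x :=
    (hF.differentiable_iteratedFDeriv (by exact_mod_cast hj)) x
  rw [iteratedFDeriv_succ_apply_left]
  have h := ((ContinuousMultilinearMap.apply ℝ (fun _ : Fin j => E) ℝ
    (Fin.tail m)).hasFDerivAt.comp x hd.hasFDerivAt).fderiv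
  have h2 : fderiv ℝ (fun y => iteratedFDeriv ℝ j F y (Fin.tail m)) x = _ := h
  rw [h2]
  rfl

lemma foldr_pder_eq {F : Ec n → ℝ} {k : ℕ} (hF : ContDiff ℝ k F) (L : List (Fin n))
    (hL : L.length ≤ k) :
    L.foldr pder F = fun x => iteratedFDeriv ℝ L.length F x
      (fun l => EuclideanSpace.single (L.get l) 1) := by
  induction L with
  | nil => funext x; simp
  | cons i L ih =>
    funext x
    rw [List.foldr_cons, ih (by simp at hL; omega)]
    exact (iteratedFDeriv_succ_apply_fderiv hF (by simpa using hL) x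
      fun l => EuclideanSpace.single ((i :: L).get l) 1).symm

/-- The list of directions in which `pderMulti α` differentiates. -/
def multiIdxList (α : Fin n →₀ ℕ) : List (Fin n) :=
  (α.support.sort (· ≤ ·)).flatMap fun i => List.replicate (α i) i

lemma pderMulti_eq_foldr (α : Fin n →₀ ℕ) (F : Ec n → ℝ) :
    pderMulti α F = (multiIdxList α).foldr pder F := by
  have h : ∀ (i : Fin n) (m : ℕ) (G : Ec n → ℝ),
      (List.replicate m i).foldr pder G = (pder i)^[m] G := by
    intro i m G
    induction m with
    | zero => rfl
    | succ m ih => rw [List.replicate_succ, List.foldr_cons, ih, Function.iterate_succ_apply']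
  simp only [pderMulti, multiIdxList, List.foldr_flatMap, h]

lemma sum_multiIdxList (α : Fin n →₀ ℕ) :
    ((multiIdxList α).map fun i => Finsupp.single i 1).sum = α := by
  have h : ∀ L : List (Fin n), (((L.flatMap fun i => List.replicate (α i) i)).map
      fun i => Finsupp.single i 1).sum = (L.map fun i => Finsupp.single i (α i)).sum := by
    intro L
    induction L with
    | nil => rfl
    | cons i L ih => simp [ih]
  rw [multiIdxList, h, ← Multiset.sum_coe, ← Multiset.map_coe, Finset.sort_eq]
  exact Finsupp.sum_single α

lemma length_multiIdxList (α : Fin n →₀ ℕ) : (multiIdxList α).length = mdeg α := by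
  rw [multiIdxList, List.length_flatMap, mdeg, Finsupp.sum, ← Multiset.sum_coe, ← Multiset.map_coe]
  simp

/-- Partial derivatives of order at most `k` of a `C^k` function are determined by its iterated
Fréchet derivatives. -/
lemma pderMulti_eq_of_iteratedFDeriv_eq {F G : Ec n → ℝ} {k : ℕ} (hF : ContDiff ℝ k F)
    (hG : ContDiff ℝ k G) {x : Ec n}
    (h : ∀ j ≤ k, iteratedFDeriv ℝ j F x = iteratedFDeriv ℝ j G x)
    (α : Fin n →₀ ℕ) (hα : mdeg α ≤ k) : pderMulti α F x = pderMulti α G x := by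
  have hL : (multiIdxList α).length ≤ k := by rwa [length_multiIdxList]
  rw [pderMulti_eq_foldr, pderMulti_eq_foldr, foldr_pder_eq hF _ hL, foldr_pder_eq hG _ hL]
  simp only [h _ hL]

namespace IsDerivFamily

variable {T : (Fin n →₀ ℕ) → Ec n → ℝ}

lemma pderMulti_eq (hT : IsDerivFamily T) (α : Fin n →₀ ℕ) : pderMulti α (T 0) = T α := by
  have h : ∀ L : List (Fin n),
      L.foldr pder (T 0) = T (L.map fun i => Finsupp.single i 1).sum := by
    intro L
    induction L with
    | nil => rfl
    | cons i L ih => rw [List.foldr_cons, ih, hT.pder_eq, List.map_cons, List.sum_cons, add_comm]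
  rw [pderMulti_eq_foldr, h, sum_multiIdxList]

lemma iteratedFDeriv_apply (hT : IsDerivFamily T) (α : Fin n →₀ ℕ) (x : Ec n) {j : ℕ}
    (s : Fin j → Fin n) :
    iteratedFDeriv ℝ j (T α) x (fun l => EuclideanSpace.single (s l) 1) =
      T (α + ∑ l, Finsupp.single (s l) 1) x := by
  induction j generalizing x with
  | zero => simp
  | succ j ih =>
    rw [iteratedFDeriv_succ_apply_fderiv (hT.contDiff_nat (j + 1) α) (Nat.lt_succ_self j)]
    have h := congrFun (hT.pder_eq (α + ∑ l, Finsupp.single (Fin.tail s l) 1) (s 0)) x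
    rw [Fin.sum_univ_succ, add_comm (Finsupp.single (s 0) 1), ← add_assoc]
    refine Eq.trans ?_ h
    rw [pder]
    congr 2
    funext y
    exact ih y (Fin.tail s)

end IsDerivFamily

end DerivFamily

section TaylorFamily

variable {n : ℕ}

/-- The partial derivatives of the Taylor polynomial of order `k` at `y` with coefficients `g`. -/
def taylorFamily (k : ℕ) (g : (Fin n →₀ ℕ) → ℝ) (y : Ec n) (α : Fin n →₀ ℕ) (x : Ec n) : ℝ :=
  ∑ β ∈ multiIdxLe n k, (if mdeg (α + β) ≤ k then g (α + β) else 0) / mfact β * mpow β (x - y)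

lemma isDerivFamily_taylorFamily (k : ℕ) (g : (Fin n →₀ ℕ) → ℝ) (y : Ec n) :
    IsDerivFamily (taylorFamily k g y) := by
  intro α x
  have hβ : ∀ β : Fin n →₀ ℕ, HasFDerivAt (fun x : Ec n =>
      (if mdeg (α + β) ≤ k then g (α + β) else 0) / mfact β * mpow β (x - y)) _ x := fun β =>
    ((hasFDerivAt_mpow β (x - y)).comp x ((hasFDerivAt_id x).sub_const y)).const_mul _
  refine (HasFDerivAt.fun_sum (u := multiIdxLe n k) fun β _ => hβ β).congr_fderiv ?_
  simp only [ContinuousLinearMap.comp_id, Finset.smul_sum, smul_smul]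
  rw [Finset.sum_comm]
  refine Finset.sum_congr rfl fun i _ => ?_
  rw [← Finset.sum_smul]
  congr 1
  have hterm : ∀ β : Fin n →₀ ℕ,
      (if mdeg (α + (β + Finsupp.single i 1)) ≤ k then g (α + (β + Finsupp.single i 1)) else 0) /
        mfact (β + Finsupp.single i 1) * (((β + Finsupp.single i 1 : Fin n →₀ ℕ) i : ℝ) *
          mpow (β + Finsupp.single i 1 - Finsupp.single i 1) (x - y)) =
      (if mdeg (α + Finsupp.single i 1 + β) ≤ k then g (α + Finsupp.single i 1 + β) else 0) /
        mfact β * mpow β (x - y) := by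
    intro β
    have h0 := mfact_ne_zero β
    have h1 : (β i : ℝ) + 1 ≠ 0 := by positivity
    rw [add_tsub_cancel_right, mfact_add_single, add_comm β, ← add_assoc]
    simp only [Finsupp.add_apply, Finsupp.single_eq_same, Nat.cast_add, Nat.cast_one]
    field_simp
    ring
  symm
  refine Finset.sum_bij_ne_zero (fun β _ _ => β + Finsupp.single i 1) (fun β _ hne => ?_)
    (fun β _ _ γ _ _ h => add_right_cancel h) (fun β hβ hne => ?_)
    (fun β _ _ => (hterm β).symm)
  · have hle : mdeg (α + Finsupp.single i 1 + β) ≤ k := by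
      by_contra hlt
      exact hne (by rw [if_neg hlt, zero_div, zero_mul])
    rw [mdeg_add, mdeg_add] at hle
    rw [mem_multiIdxLe, mdeg_add]
    omega
  · have hi : Finsupp.single i 1 ≤ β := by
      rw [Finsupp.single_le_iff, Nat.one_le_iff_ne_zero]
      intro h0
      exact hne (by simp [h0])
    have hβ' : β - Finsupp.single i 1 + Finsupp.single i 1 = β := tsub_add_cancel_of_le hi
    refine ⟨β - Finsupp.single i 1, ?_, ?_, hβ'⟩
    · have h := mem_multiIdxLe.1 hβ
      rw [← hβ', mdeg_add] at h
      rw [mem_multiIdxLe]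
      omega
    · rw [← hterm, hβ']
      exact hne

lemma taylorFamily_eq (k : ℕ) (g : (Fin n →₀ ℕ) → ℝ) (y : Ec n) {α : Fin n →₀ ℕ}
    (hα : mdeg α ≤ k) (x : Ec n) :
    taylorFamily k g y α x =
      ∑ β ∈ multiIdxLe n (k - mdeg α), g (α + β) / mfact β * mpow β (x - y) := by
  refine (Finset.sum_subset_zero_on_sdiff (fun β hβ => ?_) (fun β hβ => ?_) fun β hβ => ?_).symm
  · rw [mem_multiIdxLe] at hβ ⊢
    omega
  · rw [Finset.mem_sdiff, mem_multiIdxLe, mem_multiIdxLe] at hβ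
    rw [if_neg (by rw [mdeg_add]; omega), zero_div, zero_mul]
  · rw [mem_multiIdxLe] at hβ
    rw [if_pos (by rw [mdeg_add]; omega)]

lemma taylorFamily_of_lt (k : ℕ) (g : (Fin n →₀ ℕ) → ℝ) (y : Ec n) {α : Fin n →₀ ℕ}
    (hα : k < mdeg α) (x : Ec n) : taylorFamily k g y α x = 0 := by
  refine Finset.sum_eq_zero fun β _ => ?_
  rw [if_neg (by rw [mdeg_add]; omega), zero_div, zero_mul]

lemma taylorFamily_self (k : ℕ) (g : (Fin n →₀ ℕ) → ℝ) (y : Ec n) {α : Fin n →₀ ℕ}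
    (hα : mdeg α ≤ k) : taylorFamily k g y α y = g α := by
  rw [taylorFamily, Finset.sum_eq_single 0]
  · simp [hα, mfact, mpow]
  · intro β _ hβ
    rw [sub_self, mpow_zero_right hβ, mul_zero]
  · intro h
    exact absurd (mem_multiIdxLe.2 (by simp [mdeg])) h

/-- A multilinear form is controlled by its values on the standard basis. -/
lemma norm_multilinear_le_of_basis {j : ℕ}
    (T : ContinuousMultilinearMap ℝ (fun _ : Fin j => Ec n) ℝ) {c : ℝ} (hc : 0 ≤ c)
    (h : ∀ s : Fin j → Fin n, |T fun l => EuclideanSpace.single (s l) 1| ≤ c) :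
    ‖T‖ ≤ (n : ℝ) ^ j * c := by
  refine T.opNorm_le_bound (by positivity) fun v => ?_
  have hv : v = fun l => ∑ i, v l i • (EuclideanSpace.single i 1 : Ec n) := by
    funext l
    ext i
    simp [Finset.sum_apply, Pi.single_apply]
  have hT : T v = ∑ s : Fin j → Fin n, (∏ l, v l (s l)) •
      T fun l => EuclideanSpace.single (s l) 1 := by
    conv_lhs => rw [hv]
    rw [T.map_sum]
    exact Finset.sum_congr rfl fun s _ => T.map_smul_univ _ _
  rw [hT]
  calc ‖∑ s : Fin j → Fin n, (∏ l, v l (s l)) • T fun l => EuclideanSpace.single (s l) 1‖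
      ≤ ∑ s : Fin j → Fin n, (∏ l, ‖v l‖) * c := by
        refine norm_sum_le_of_le _ fun s _ => ?_
        rw [norm_smul, norm_prod]
        gcongr with l
        · exact PiLp.norm_apply_le (v l) (s l)
        · exact h s
    _ = (n : ℝ) ^ j * c * ∏ l, ‖v l‖ := by
        simp
        ring

lemma norm_iteratedFDeriv_sub_le_of_family {T S : (Fin n →₀ ℕ) → Ec n → ℝ} (hT : IsDerivFamily T)
    (hS : IsDerivFamily S) {j : ℕ} {x : Ec n} {c : ℝ} (hc : 0 ≤ c)
    (h : ∀ α, mdeg α = j → |T α x - S α x| ≤ c) :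
    ‖iteratedFDeriv ℝ j (T 0) x - iteratedFDeriv ℝ j (S 0) x‖ ≤ (n : ℝ) ^ j * c := by
  refine norm_multilinear_le_of_basis _ hc fun s => ?_
  rw [sub_apply, hT.iteratedFDeriv_apply, hS.iteratedFDeriv_apply, zero_add]
  exact h _ (by rw [mdeg_sum_single]; simp)

lemma iteratedFDeriv_taylorFamily_of_lt (k : ℕ) (g : (Fin n →₀ ℕ) → ℝ) (y x : Ec n) {j : ℕ}
    (hj : k < j) : iteratedFDeriv ℝ j (taylorFamily k g y 0) x = 0 := by
  rw [← norm_le_zero_iff, ← mul_zero ((n : ℝ) ^ j)]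
  refine norm_multilinear_le_of_basis _ le_rfl fun s => ?_
  rw [(isDerivFamily_taylorFamily k g y).iteratedFDeriv_apply,
    taylorFamily_of_lt k g y (by rw [zero_add, mdeg_sum_single]; simpa using hj), abs_zero]

end TaylorFamily

section LocallyFiniteSum

variable {n : ℕ} {ι : Type*}

lemma eventuallyEq_finsum {X : Type*} [TopologicalSpace X] {g : ι → X → ℝ} {x : X} {S : Finset ι}
    (h : ∀ᶠ y in nhds x, ∀ i ∉ S, g i y = 0) :
    (fun y => ∑ᶠ i, g i y) =ᶠ[nhds x] fun y => ∑ i ∈ S, g i y := by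
  filter_upwards [h] with y hy
  refine finsum_eq_sum_of_support_subset _ fun i hi => ?_
  by_contra hiS
  exact hi (hy i hiS)

lemma contDiffAt_finsum {g : ι → Ec n → ℝ} {m : WithTop ℕ∞} {x : Ec n} {S : Finset ι}
    (hg : ∀ i, ContDiffAt ℝ m (g i) x) (h : ∀ᶠ y in nhds x, ∀ i ∉ S, g i y = 0) :
    ContDiffAt ℝ m (fun y => ∑ᶠ i, g i y) x :=
  (ContDiffAt.sum fun i _ => hg i).congr_of_eventuallyEq (eventuallyEq_finsum h)

lemma norm_iteratedFDeriv_finsum_le {g : ι → Ec n → ℝ} {x : Ec n} {S : Finset ι} {j N : ℕ} {b : ℝ}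
    (hb : 0 ≤ b) (hg : ∀ i, ContDiffAt ℝ j (g i) x)
    (h : ∀ᶠ y in nhds x, ∀ i ∉ S, g i y = 0) (hS : S.card ≤ N)
    (hgb : ∀ i, ‖iteratedFDeriv ℝ j (g i) x‖ ≤ b) :
    ‖iteratedFDeriv ℝ j (fun y => ∑ᶠ i, g i y) x‖ ≤ N * b := by
  rw [((eventuallyEq_finsum h).iteratedFDeriv ℝ j).self_of_nhds,
    iteratedFDeriv_fun_sum_apply fun i _ => hg i]
  calc ‖∑ i ∈ S, iteratedFDeriv ℝ j (g i) x‖ ≤ ∑ _i ∈ S, b :=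
        norm_sum_le_of_le _ fun i _ => hgb i
    _ = S.card * b := by simp
    _ ≤ N * b := by gcongr

end LocallyFiniteSum

section LatticePartition

/-- A smooth bump supported in `[-1, 1]` whose integer translates sum to one. -/
def unitBump (t : ℝ) : ℝ := Real.smoothTransition (t + 1) - Real.smoothTransition t

lemma contDiff_unitBump : ContDiff ℝ ((⊤ : ℕ∞) : WithTop ℕ∞) unitBump :=
  (Real.smoothTransition.contDiff.comp (contDiff_id.add contDiff_const)).sub
    Real.smoothTransition.contDiff

lemma unitBump_eq_zero {t : ℝ} (ht : 1 ≤ |t|) : unitBump t = 0 := by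
  rcases le_abs.1 ht with h | h
  · rw [unitBump, Real.smoothTransition.one_of_one_le (by linarith),
      Real.smoothTransition.one_of_one_le h, sub_self]
  · rw [unitBump, Real.smoothTransition.zero_of_nonpos (by linarith),
      Real.smoothTransition.zero_of_nonpos (by linarith), sub_self]

lemma sum_unitBump {c : ℤ} {t : ℝ} (h1 : c - 1 ≤ t) (h2 : t ≤ c + 2) :
    ∑ m ∈ Finset.Icc (c - 1) (c + 2), unitBump (t - m) = 1 := by
  have hI : Finset.Icc (c - 1) (c + 2) = {c - 1, c, c + 1, c + 2} := by
    ext m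
    simp only [Finset.mem_Icc, Finset.mem_insert, Finset.mem_singleton]
    omega
  have e1 : Real.smoothTransition (t - c + 2) = 1 :=
    Real.smoothTransition.one_of_one_le (by linarith)
  have e2 : Real.smoothTransition (t - c - 2) = 0 :=
    Real.smoothTransition.zero_of_nonpos (by linarith)
  rw [hI, Finset.sum_insert (by simp; omega), Finset.sum_insert (by simp),
    Finset.sum_insert (by simp), Finset.sum_singleton]
  simp only [unitBump]
  push_cast
  rw [show t - (c - 1) + 1 = t - c + 2 by ring, show t - ((c : ℝ) - 1) = t - c + 1 by ring,
    show t - (c + 1) + 1 = t - (c : ℝ) by ring, show t - (c + 2) + 1 = t - (c + 1 : ℝ) by ring,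
    show t - ((c : ℝ) + 2) = t - c - 2 by ring, e1, e2]
  ring

variable {n : ℕ}

/-- The tensor product of `n` copies of `unitBump`. -/
def cubeBump (x : Ec n) : ℝ := ∏ i, unitBump (x i)

lemma contDiff_cubeBump : ContDiff ℝ ((⊤ : ℕ∞) : WithTop ℕ∞) (cubeBump : Ec n → ℝ) :=
  contDiff_prod fun i _ =>
    contDiff_unitBump.comp (EuclideanSpace.proj i : Ec n →L[ℝ] ℝ).contDiff

lemma abs_lt_one_of_cubeBump_ne_zero {x : Ec n} (hx : cubeBump x ≠ 0) (i : Fin n) :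
    |x i| < 1 := by
  by_contra h
  exact hx (Finset.prod_eq_zero (Finset.mem_univ i) (unitBump_eq_zero (not_lt.1 h)))

lemma norm_le_of_cubeBump_ne_zero {x : Ec n} (hx : cubeBump x ≠ 0) : ‖x‖ ≤ n + 1 := by
  rw [EuclideanSpace.norm_eq]
  refine Real.sqrt_le_iff.2 ⟨by positivity, ?_⟩
  calc ∑ i, ‖x i‖ ^ 2 ≤ ∑ _i : Fin n, (1 : ℝ) := by
        refine Finset.sum_le_sum fun i _ => ?_
        exact pow_le_one₀ (norm_nonneg _) (abs_lt_one_of_cubeBump_ne_zero hx i).le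
    _ ≤ ((n : ℝ) + 1) ^ 2 := by
        simp
        nlinarith [Nat.cast_nonneg (α := ℝ) n]

lemma hasCompactSupport_cubeBump : HasCompactSupport (cubeBump : Ec n → ℝ) :=
  HasCompactSupport.of_support_subset_isCompact (isCompact_closedBall (0 : Ec n) (n + 1))
    fun x hx => by simpa using norm_le_of_cubeBump_ne_zero hx

lemma exists_bound_cubeBump (n j : ℕ) :
    ∃ b, ∀ x : Ec n, ‖iteratedFDeriv ℝ j (cubeBump : Ec n → ℝ) x‖ ≤ b :=
  (hasCompactSupport_cubeBump.iteratedFDeriv j).exists_bound_of_continuous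
    (contDiff_cubeBump.continuous_iteratedFDeriv (by exact_mod_cast le_top))

/-- The index set of the translates of `cubeBump` that meet a neighbourhood of `u`. -/
def cubeIdx (u : Ec n) : Finset (Fin n → ℤ) :=
  Fintype.piFinset fun i => Finset.Icc (⌊u i⌋ - 1) (⌊u i⌋ + 2)

lemma card_cubeIdx (u : Ec n) : (cubeIdx u).card = 4 ^ n := by
  rw [cubeIdx, Fintype.card_piFinset]
  simp [show ∀ a : ℤ, (a + 2 + 1 - (a - 1)).toNat = 4 by intro a; omega]

lemma cubeBump_sub_eq_zero {u v : Ec n} (huv : ∀ i, |v i - u i| < 1) {z : Fin n → ℤ}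
    (hz : z ∉ cubeIdx u) : cubeBump (v - WithLp.toLp 2 fun i => (z i : ℝ)) = 0 := by
  by_contra h
  refine hz (Fintype.mem_piFinset.2 fun i => ?_)
  have h1 := abs_lt.1 (abs_lt_one_of_cubeBump_ne_zero h i)
  have h2 := abs_lt.1 (huv i)
  simp only [PiLp.sub_apply] at h1
  have h3 := Int.floor_le (u i)
  have h4 := Int.lt_floor_add_one (u i)
  rw [Finset.mem_Icc]
  constructor
  · have : ((⌊u i⌋ : ℤ) : ℝ) - 2 < z i := by linarith
    have : ⌊u i⌋ - 2 < z i := by exact_mod_cast this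
    omega
  · have : (z i : ℝ) < (⌊u i⌋ : ℤ) + 3 := by linarith
    have : z i < ⌊u i⌋ + 3 := by exact_mod_cast this
    omega

lemma sum_cubeBump_sub {u v : Ec n} (huv : ∀ i, |v i - u i| < 1) :
    ∑ z ∈ cubeIdx u, cubeBump (v - WithLp.toLp 2 fun i => (z i : ℝ)) = 1 := by
  simp only [cubeBump, PiLp.sub_apply, cubeIdx]
  rw [← Finset.prod_univ_sum (fun i => Finset.Icc (⌊u i⌋ - 1) (⌊u i⌋ + 2))
    fun i m => unitBump (v i - (m : ℝ))]
  refine Finset.prod_eq_one fun i _ => sum_unitBump ?_ ?_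
  · have := abs_lt.1 (huv i)
    linarith [Int.floor_le (u i)]
  · have := abs_lt.1 (huv i)
    linarith [Int.lt_floor_add_one (u i)]

/-- A smooth partition of unity at scale `r`: each function lives in a ball of radius `r` about its
center, at most `N` of them meet near each point, and derivatives of order `j` are bounded by
`B j / r ^ j`. -/
structure IsScalePartition (B : ℕ → ℝ) (N : ℕ) (r : ℝ) {ι : Type*} (χ : ι → Ec n → ℝ)
    (c : ι → Ec n) : Prop where
  contDiff : ∀ z, ContDiff ℝ ((⊤ : ℕ∞) : WithTop ℕ∞) (χ z)
  norm_le : ∀ z j x, ‖iteratedFDeriv ℝ j (χ z) x‖ ≤ B j / r ^ j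
  norm_sub_le : ∀ z x, χ z x ≠ 0 → ‖x - c z‖ ≤ r
  locallyFinite : ∀ x, ∃ S : Finset ι, S.card ≤ N ∧
    ∀ᶠ y in nhds x, (∀ z ∉ S, χ z y = 0) ∧ ∑ z ∈ S, χ z y = 1

lemma exists_isScalePartition (n : ℕ) : ∃ (B : ℕ → ℝ) (N : ℕ), ∀ r : ℝ, 0 < r →
    ∃ (χ : (Fin n → ℤ) → Ec n → ℝ) (c : (Fin n → ℤ) → Ec n), IsScalePartition B N r χ c := by
  choose b hb using exists_bound_cubeBump n
  refine ⟨fun j => ((n : ℝ) + 1) ^ j * b j, 4 ^ n, fun r hr => ?_⟩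
  set a : ℝ := (n + 1) / r with ha
  have ha0 : 0 < a := by positivity
  set w : (Fin n → ℤ) → Ec n := fun z => WithLp.toLp 2 fun i => (z i : ℝ) with hw
  refine ⟨fun z x => cubeBump (a • x - w z), fun z => a⁻¹ • w z, ?_, ?_, ?_, ?_⟩
  · exact fun z => contDiff_cubeBump.comp ((contDiff_const_smul a).sub contDiff_const)
  · intro z j x
    have h1 : ContDiff ℝ j fun u : Ec n => cubeBump (u - w z) :=
      (contDiff_cubeBump.comp (contDiff_id.sub contDiff_const)).of_le (by exact_mod_cast le_top)
    have h2 := congrFun (iteratedFDeriv_comp_const_smul a h1) x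
    rw [h2, iteratedFDeriv_comp_sub, norm_smul, norm_pow, Real.norm_of_nonneg ha0.le]
    calc a ^ j * _ ≤ a ^ j * b j := by gcongr; exact hb j _
      _ = _ := by rw [ha, div_pow]; ring
  · intro z x hx
    have h := norm_le_of_cubeBump_ne_zero hx
    have h2 : x - a⁻¹ • w z = a⁻¹ • (a • x - w z) := by
      rw [smul_sub, smul_smul, inv_mul_cancel₀ ha0.ne', one_smul]
    rw [h2, norm_smul, Real.norm_of_nonneg (by positivity)]
    calc a⁻¹ * ‖a • x - w z‖ ≤ a⁻¹ * (n + 1) := by gcongr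
      _ = r := by rw [ha]; field_simp
  · intro x
    refine ⟨cubeIdx (a • x), (card_cubeIdx _).le, ?_⟩
    have h : ∀ᶠ y in nhds x, ∀ i, |(a • y) i - (a • x) i| < 1 := by
      refine eventually_all.2 fun i => ?_
      have hc : Continuous fun y : Ec n => |(a • y) i - (a • x) i| := by fun_prop
      exact hc.continuousAt.eventually_lt continuousAt_const (by simp)
    filter_upwards [h] with y hy
    exact ⟨fun z hz => cubeBump_sub_eq_zero hy hz, sum_cubeBump_sub hy⟩

end LatticePartition

section WhitneyPartition

variable {n : ℕ}

/-- A smooth cutoff equal to one at distance at most `r` from `A` and zero at distance more than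
`3 * r`, with derivatives of order `j` bounded by `b / r ^ j`. -/
lemma IsScalePartition.exists_cutoff {B : ℕ → ℝ} {N : ℕ} {r : ℝ} {ι : Type*}
    {χ : ι → Ec n → ℝ} {c : ι → Ec n} (hχ : IsScalePartition B N r χ c)
    (A : Set (Ec n)) :
    ∃ h : Ec n → ℝ, ContDiff ℝ ((⊤ : ℕ∞) : WithTop ℕ∞) h ∧
      (∀ j x, ‖iteratedFDeriv ℝ j h x‖ ≤ N * (B j / r ^ j)) ∧
      (∀ x, infDist x A ≤ r → h x = 1) ∧ ∀ x, 3 * r < infDist x A → h x = 0 := by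
  classical
  set g : ι → Ec n → ℝ := fun z x => if infDist (c z) A ≤ 2 * r then χ z x else 0 with hg
  have hgeq : ∀ z, g z = if infDist (c z) A ≤ 2 * r then χ z else fun _ => 0 := by
    intro z
    funext x
    simp only [hg]
    split_ifs <;> rfl
  have hgsmooth : ∀ z, ContDiff ℝ ((⊤ : ℕ∞) : WithTop ℕ∞) (g z) := by
    intro z
    rw [hgeq]
    split_ifs
    · exact hχ.contDiff z
    · exact contDiff_const
  have hgbound : ∀ z j x, ‖iteratedFDeriv ℝ j (g z) x‖ ≤ B j / r ^ j := by
    intro z j x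
    have h := hχ.norm_le z j x
    rw [hgeq]
    split_ifs
    · exact h
    · rw [iteratedFDeriv_fun_zero, Pi.zero_apply, norm_zero]
      exact (norm_nonneg _).trans h
  have hgloc : ∀ x, ∃ S : Finset ι, S.card ≤ N ∧ ∀ᶠ y in nhds x, ∀ z ∉ S, g z y = 0 := by
    intro x
    obtain ⟨S, hS, h⟩ := hχ.locallyFinite x
    refine ⟨S, hS, h.mono fun y hy z hz => ?_⟩
    simp only [hg, hy.1 z hz, ite_self]
  refine ⟨fun x => ∑ᶠ z, g z x, ?_, ?_, ?_, ?_⟩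
  · rw [contDiff_iff_contDiffAt]
    intro x
    obtain ⟨S, -, hS⟩ := hgloc x
    exact contDiffAt_finsum (fun z => (hgsmooth z).contDiffAt) hS
  · intro j x
    obtain ⟨S, hcard, hS⟩ := hgloc x
    by_cases hι : Nonempty ι
    · obtain ⟨z⟩ := hι
      exact norm_iteratedFDeriv_finsum_le ((norm_nonneg _).trans (hgbound z j x))
        (fun z => (hgsmooth z).contDiffAt.of_le (by exact_mod_cast le_top)) hS hcard
        fun z => hgbound z j x
    · obtain ⟨S', -, h⟩ := hχ.locallyFinite x
      have h1 := h.self_of_nhds.2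
      rw [Finset.sum_eq_zero fun z _ => absurd ⟨z⟩ hι] at h1
      exact absurd h1 zero_ne_one
  · intro x hx
    obtain ⟨S, -, h⟩ := hχ.locallyFinite x
    obtain ⟨h0, h1⟩ := h.self_of_nhds
    have hgχ : ∀ z, g z x = χ z x := by
      intro z
      by_cases hz : χ z x = 0
      · simp only [hg, hz, ite_self]
      · refine if_pos ?_
        have := hχ.norm_sub_le z x hz
        have h2 := infDist_le_infDist_add_dist (s := A) (x := c z) (y := x)
        rw [dist_comm, dist_eq_norm] at h2
        linarith
    simp only [hgχ]
    rw [finsum_eq_sum_of_support_subset _ fun z hz => by_contra fun hzS => hz (h0 z hzS)]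
    exact h1
  · intro x hx
    refine finsum_eq_zero_of_forall_eq_zero fun z => ?_
    by_cases hz : χ z x = 0
    · simp only [hg, hz, ite_self]
    · refine if_neg ?_
      have := hχ.norm_sub_le z x hz
      have h2 := infDist_le_infDist_add_dist (s := A) (x := x) (y := c z)
      rw [dist_eq_norm] at h2
      linarith

/-- A Whitney partition of unity on the complement of `A`, with a point `a i` of `A` attached to
each function. -/
structure IsWhitneyPartition (A : Set (Ec n)) (B : ℕ → ℝ) (N : ℕ) {ι : Type*}
    (φ : ι → Ec n → ℝ) (a : ι → Ec n) : Prop where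
  contDiff : ∀ i, ContDiff ℝ ((⊤ : ℕ∞) : WithTop ℕ∞) (φ i)
  mem : ∀ i, a i ∈ A
  norm_le : ∀ i j x, x ∉ A → ‖iteratedFDeriv ℝ j (φ i) x‖ ≤ B j / infDist x A ^ j
  norm_sub_le : ∀ i x, φ i x ≠ 0 → ‖x - a i‖ ≤ 3 * infDist x A
  locallyFinite : ∀ x ∉ A, ∃ S : Finset ι, S.card ≤ N ∧
    ∀ᶠ y in nhds x, (∀ i ∉ S, φ i y = 0) ∧ ∑ i ∈ S, φ i y = 1

lemma sum_Ico_sub_int (h : ℤ → ℝ) (p : ℤ) (m : ℕ) :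
    ∑ l ∈ Finset.Ico p (p + m), (h (l + 1) - h l) = h (p + m) - h p := by
  induction m with
  | zero => simp
  | succ m ih =>
    have hI : Finset.Ico p (p + (m + 1 : ℕ)) = insert (p + m) (Finset.Ico p (p + m)) := by
      ext l
      simp only [Finset.mem_Ico, Finset.mem_insert]
      omega
    rw [hI, Finset.sum_insert (by simp), ih]
    push_cast
    rw [add_assoc]
    ring

/-- The dyadic range of scales active near a point at distance `d`. -/
lemma exists_dyadic_range {d : ℝ} (hd : 0 < d) :
    ∃ p : ℤ, 3 * (2 : ℝ) ^ p < d / 2 ∧ 2 * d < (2 : ℝ) ^ (p + (6 : ℕ)) := by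
  obtain ⟨q, hq1, hq2⟩ := exists_mem_Ico_zpow hd (one_lt_two (α := ℝ))
  refine ⟨q - 4, ?_, ?_⟩
  · rw [zpow_sub₀ two_ne_zero]
    norm_num
    linarith [zpow_pos (two_pos (α := ℝ)) q]
  · rw [show q - 4 + ((6 : ℕ) : ℤ) = q + 1 + 1 by push_cast; ring, zpow_add_one₀ two_ne_zero]
    linarith

lemma exists_isWhitneyPartition {A : Set (Ec n)} (hA : IsClosed A) (hne : A.Nonempty) :
    ∃ (B : ℕ → ℝ) (N : ℕ) (φ : ℤ × (Fin n → ℤ) → Ec n → ℝ) (a : ℤ × (Fin n → ℤ) → Ec n),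
      IsWhitneyPartition A B N φ a := by
  classical
  obtain ⟨B, N, hBN⟩ := exists_isScalePartition n
  have hr : ∀ m : ℤ, (0 : ℝ) < 2 ^ m := fun m => zpow_pos two_pos m
  choose χ c hχ using fun m : ℤ => hBN (2 ^ m) (hr m)
  choose h hsmooth hbound hone hzero using fun m : ℤ => (hχ m).exists_cutoff A
  choose a haA ha using fun p : ℤ × (Fin n → ℤ) => hA.exists_infDist_eq_dist hne (c p.1 p.2)
  have hmono : ∀ {l m : ℤ}, l ≤ m → (2 : ℝ) ^ l ≤ 2 ^ m := fun hlm =>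
    zpow_le_zpow_right₀ one_le_two hlm
  have hB : ∀ j, 0 ≤ B j := fun j => by
    have := (norm_nonneg _).trans ((hχ 0).norm_le 0 j 0)
    simpa using this
  set ψ : ℤ → Ec n → ℝ := fun m x => h (m + 1) x - h m x with hψ
  have hψsmooth : ∀ m, ContDiff ℝ ((⊤ : ℕ∞) : WithTop ℕ∞) (ψ m) := fun m =>
    (hsmooth (m + 1)).sub (hsmooth m)
  have hψbound : ∀ m j x, ‖iteratedFDeriv ℝ j (ψ m) x‖ ≤ 2 * N * B j / (2 ^ m) ^ j := by
    intro m j x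
    have hs : ∀ m, ContDiffAt ℝ j (h m) x := fun m =>
      (hsmooth m).contDiffAt.of_le (by exact_mod_cast le_top)
    have heq : iteratedFDeriv ℝ j (ψ m) x =
        iteratedFDeriv ℝ j (h (m + 1)) x - iteratedFDeriv ℝ j (h m) x :=
      iteratedFDeriv_sub_apply (hs _) (hs _)
    rw [heq]
    have h1 : N * (B j / ((2 : ℝ) ^ (m + 1)) ^ j) ≤ N * (B j / (2 ^ m) ^ j) := by
      have := hr m
      have := hB j
      have := hmono (show m ≤ m + 1 by omega)
      gcongr
    calc _ ≤ _ := norm_sub_le _ _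
      _ ≤ N * (B j / (2 ^ m) ^ j) + N * (B j / (2 ^ m) ^ j) :=
        add_le_add ((hbound (m + 1) j x).trans h1) (hbound m j x)
      _ = _ := by ring
  have hψsupp : ∀ m x, ψ m x ≠ 0 → (2 : ℝ) ^ m < infDist x A ∧ infDist x A ≤ 6 * 2 ^ m := by
    intro m x hx
    by_contra hcon
    refine hx ?_
    rw [not_and_or, not_lt, not_le] at hcon
    have h2 : (2 : ℝ) ^ (m + 1) = 2 * 2 ^ m := by rw [zpow_add_one₀ two_ne_zero]; ring
    have := hr m
    rcases hcon with hcon | hcon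
    · simp only [hψ, hone m x hcon, hone (m + 1) x (by linarith), sub_self]
    · simp only [hψ, hzero m x (by linarith), hzero (m + 1) x (by linarith), sub_self]
  set φ : ℤ × (Fin n → ℤ) → Ec n → ℝ := fun p x => ψ p.1 x * χ p.1 p.2 x with hφ
  have hφbound : ∀ p j x, ‖iteratedFDeriv ℝ j (φ p) x‖ ≤
      (∑ i ∈ Finset.range (j + 1), (j.choose i : ℝ) * (2 * N * B i) * B (j - i)) /
        (2 ^ p.1) ^ j := by
    intro p j x
    refine (norm_iteratedFDeriv_mul_le (hψsmooth p.1) ((hχ p.1).contDiff p.2) x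
      (n := j) (by exact_mod_cast le_top)).trans ?_
    rw [Finset.sum_div]
    refine Finset.sum_le_sum fun i hi => ?_
    have hij : i + (j - i) = j := by
      have := Finset.mem_range.1 hi
      omega
    calc (j.choose i : ℝ) * ‖iteratedFDeriv ℝ i (ψ p.1) x‖ *
          ‖iteratedFDeriv ℝ (j - i) (χ p.1 p.2) x‖
        ≤ j.choose i * (2 * N * B i / (2 ^ p.1) ^ i) * (B (j - i) / (2 ^ p.1) ^ (j - i)) := by
          have := hB i
          have := hr p.1
          gcongr
          · exact hψbound p.1 i x
          · exact (hχ p.1).norm_le p.2 (j - i) x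
      _ = j.choose i * (2 * N * B i) * B (j - i) / ((2 ^ p.1) ^ i * (2 ^ p.1) ^ (j - i)) := by
          field_simp
      _ = _ := by rw [← pow_add, hij]
  have hdist : ∀ x ∉ A, 0 < infDist x A := fun x hx => (hA.notMem_iff_infDist_pos hne).1 hx
  refine ⟨fun j => 6 ^ j * ∑ i ∈ Finset.range (j + 1), (j.choose i : ℝ) * (2 * N * B i) * B (j - i),
    6 * N, φ, a, ?_, haA, ?_, ?_, ?_⟩
  · exact fun p => (hψsmooth p.1).mul ((hχ p.1).contDiff p.2)
  · intro p j x hx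
    have hd := hdist x hx
    have hsum : 0 ≤ ∑ i ∈ Finset.range (j + 1), (j.choose i : ℝ) * (2 * N * B i) * B (j - i) :=
      Finset.sum_nonneg fun i _ => by
        have := hB i
        have := hB (j - i)
        positivity
    by_cases hs : x ∈ tsupport (φ p)
    · have hclosed : IsClosed {y : Ec n | infDist y A ≤ 6 * 2 ^ p.1} :=
        isClosed_le (continuous_infDist_pt A) continuous_const
      have hle : infDist x A ≤ 6 * 2 ^ p.1 := by
        refine closure_minimal (fun y hy => ?_) hclosed hs
        exact (hψsupp p.1 y (left_ne_zero_of_mul hy)).2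
      refine (hφbound p j x).trans ?_
      have h1 : infDist x A ^ j ≤ 6 ^ j * (2 ^ p.1) ^ j := by
        rw [← mul_pow]
        exact pow_le_pow_left₀ hd.le hle j
      have hp := hr p.1
      rw [div_le_div_iff₀ (by positivity) (by positivity)]
      calc _ ≤ _ := mul_le_mul_of_nonneg_left h1 hsum
        _ = _ := by ring
    · have h0 : iteratedFDeriv ℝ j (φ p) x = 0 := by
        by_contra hcon
        exact hs (support_iteratedFDeriv_subset j hcon)
      rw [h0, norm_zero]
      positivity
  · intro p x hx
    have h1 := (hψsupp p.1 x (left_ne_zero_of_mul hx)).1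
    have h2 := (hχ p.1).norm_sub_le p.2 x (right_ne_zero_of_mul hx)
    have h3 := ha p
    have h4 := infDist_le_infDist_add_dist (s := A) (x := c p.1 p.2) (y := x)
    have h5 := dist_triangle x (c p.1 p.2) (a p)
    rw [dist_comm, dist_eq_norm] at h4
    rw [dist_eq_norm, dist_eq_norm x] at h5
    linarith
  · intro x hx
    have hd := hdist x hx
    obtain ⟨p, hp1, hp2⟩ := exists_dyadic_range hd
    choose S hcard hS using fun m : ℤ => (hχ m).locallyFinite x
    set T : Finset (ℤ × (Fin n → ℤ)) :=
      (Finset.Ico p (p + (6 : ℕ))).biUnion fun m => (S m).image fun z => (m, z) with hT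
    have hmemT : ∀ q : ℤ × (Fin n → ℤ), q ∈ T ↔
        q.1 ∈ Finset.Ico p (p + (6 : ℕ)) ∧ q.2 ∈ S q.1 := by
      rintro ⟨m, z⟩
      simp only [hT, Finset.mem_biUnion, Finset.mem_image, Prod.mk.injEq]
      constructor
      · rintro ⟨m', hm', z', hz', rfl, rfl⟩
        exact ⟨hm', hz'⟩
      · rintro ⟨hm, hz⟩
        exact ⟨m, hm, z, hz, rfl, rfl⟩
    refine ⟨T, ?_, ?_⟩
    · calc T.card ≤ ∑ m ∈ Finset.Ico p (p + (6 : ℕ)), ((S m).image fun z => (m, z)).card :=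
            Finset.card_biUnion_le
        _ ≤ ∑ _m ∈ Finset.Ico p (p + (6 : ℕ)), N :=
            Finset.sum_le_sum fun m _ => Finset.card_image_le.trans (hcard m)
        _ = 6 * N := by simp
    · have hc := continuous_infDist_pt A
      have e1 : ∀ᶠ y in nhds x, infDist x A / 2 < infDist y A :=
        continuousAt_const.eventually_lt hc.continuousAt (by linarith)
      have e2 : ∀ᶠ y in nhds x, infDist y A < 2 * infDist x A :=
        hc.continuousAt.eventually_lt continuousAt_const (by linarith)
      have e3 : ∀ᶠ y in nhds x, ∀ m ∈ Finset.Ico p (p + (6 : ℕ)),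
          (∀ z ∉ S m, χ m z y = 0) ∧ ∑ z ∈ S m, χ m z y = 1 :=
        (Finset.eventually_all _).2 fun m _ => hS m
      filter_upwards [e1, e2, e3] with y h1 h2 h3
      constructor
      · intro q hq
        by_cases hm : q.1 ∈ Finset.Ico p (p + (6 : ℕ))
        · have hz : q.2 ∉ S q.1 := fun hz => hq ((hmemT q).2 ⟨hm, hz⟩)
          simp only [hφ, (h3 q.1 hm).1 q.2 hz, mul_zero]
        · by_contra hne0
          obtain ⟨h4, h5⟩ := hψsupp q.1 y (left_ne_zero_of_mul hne0)
          rw [Finset.mem_Ico, not_and_or, not_le, not_lt] at hm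
          rcases hm with hm | hm
          · have h6 := hmono (show q.1 + 1 ≤ p by omega)
            rw [zpow_add_one₀ two_ne_zero] at h6
            linarith
          · linarith [hmono hm]
      · rw [hT, Finset.sum_biUnion]
        · calc _ = ∑ m ∈ Finset.Ico p (p + (6 : ℕ)), ψ m y := by
                refine Finset.sum_congr rfl fun m hm => ?_
                rw [Finset.sum_image fun z _ z' _ hzz => (Prod.mk.inj hzz).2]
                simp only [hφ]
                rw [← Finset.mul_sum, (h3 m hm).2, mul_one]
            _ = h (p + (6 : ℕ)) y - h p y := sum_Ico_sub_int (fun m => h m y) p 6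
            _ = 1 := by rw [hone _ y (by linarith), hzero _ y (by linarith), sub_zero]
        · intro m _ m' _ hmm
          rw [Function.onFun, Finset.disjoint_left]
          intro q hq hq'
          obtain ⟨z, -, rfl⟩ := Finset.mem_image.1 hq
          obtain ⟨z', -, h'⟩ := Finset.mem_image.1 hq'
          exact hmm (Prod.mk.inj h').1.symm

end WhitneyPartition

section WhitneyField

variable {n k : ℕ} {ω : ℝ → ℝ} {A : Set (Ec n)} {M : ℝ} {P : Ec n → Ec n → ℝ}

/-- Mean value inequality for iterated derivatives on a ball. -/
lemma norm_iteratedFDeriv_sub_le_of_ball {Q : Ec n → ℝ} {j : ℕ} {x y c : Ec n} {r b : ℝ}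
    (hQ : ∀ z, ‖z - c‖ ≤ r → ContDiffAt ℝ ((⊤ : ℕ∞) : WithTop ℕ∞) Q z)
    (hb : ∀ z, ‖z - c‖ ≤ r → ‖iteratedFDeriv ℝ (j + 1) Q z‖ ≤ b)
    (hx : ‖x - c‖ ≤ r) (hy : ‖y - c‖ ≤ r) :
    ‖iteratedFDeriv ℝ j Q y - iteratedFDeriv ℝ j Q x‖ ≤ b * ‖y - x‖ := by
  refine (convex_closedBall c r).norm_image_sub_le_of_norm_fderiv_le (𝕜 := ℝ) (fun z hz => ?_)
    (fun z hz => ?_) (mem_closedBall_iff_norm.2 hx) (mem_closedBall_iff_norm.2 hy)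
  · exact (hQ z (mem_closedBall_iff_norm.1 hz)).differentiableAt_iteratedFDeriv
      (by exact_mod_cast WithTop.coe_lt_top j)
  · rw [norm_fderiv_iteratedFDeriv]
    exact hb z (mem_closedBall_iff_norm.1 hz)

/-- A polynomial of degree at most `k` is controlled on a ball by its derivatives at the center. -/
lemma norm_iteratedFDeriv_le_of_center {Q : Ec n → ℝ}
    (hQ : ContDiff ℝ ((⊤ : ℕ∞) : WithTop ℕ∞) Q) (h0 : ∀ x, iteratedFDeriv ℝ (k + 1) Q x = 0)
    {c : Ec n} {r ε : ℝ} (hr : 0 < r) (hε : 0 ≤ ε)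
    (hc : ∀ j ≤ k, ‖iteratedFDeriv ℝ j Q c‖ ≤ ε / r ^ j) {j : ℕ} (hj : j ≤ k + 1) {x : Ec n}
    (hx : ‖x - c‖ ≤ r) : ‖iteratedFDeriv ℝ j Q x‖ ≤ (k + 1) * (ε / r ^ j) := by
  have key : ∀ i j : ℕ, i + j = k + 1 → ∀ x : Ec n, ‖x - c‖ ≤ r →
      ‖iteratedFDeriv ℝ j Q x‖ ≤ i * (ε / r ^ j) := by
    intro i
    induction i with
    | zero =>
      intro j hj x _
      obtain rfl : j = k + 1 := by omega
      simp [h0]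
    | succ i ih =>
      intro j hj x hx
      have h1 := norm_iteratedFDeriv_sub_le_of_ball (j := j) (x := c) (y := x)
        (fun z _ => hQ.contDiffAt) (ih (j + 1) (by omega)) (by simpa using hr.le) hx
      have h2 := norm_le_norm_add_norm_sub' (iteratedFDeriv ℝ j Q x) (iteratedFDeriv ℝ j Q c)
      have h3 : i * (ε / r ^ (j + 1)) * ‖x - c‖ ≤ i * (ε / r ^ (j + 1)) * r := by gcongr
      have h4 : i * (ε / r ^ (j + 1)) * r = i * (ε / r ^ j) := by
        field_simp
        ring
      push_cast
      linarith [hc j (by omega)]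
  refine (key (k + 1 - j) j (by omega) x hx).trans ?_
  gcongr
  exact_mod_cast Nat.sub_le _ _

/-- A family of polynomials of degree at most `k`, attached to the points of `A`, that satisfies
Whitney's compatibility conditions with modulus `ω`. -/
structure IsWhitneyField (k : ℕ) (ω : ℝ → ℝ) (A : Set (Ec n)) (M : ℝ)
    (P : Ec n → Ec n → ℝ) : Prop where
  contDiff : ∀ a, ContDiff ℝ ((⊤ : ℕ∞) : WithTop ℕ∞) (P a)
  iteratedFDeriv_succ : ∀ a x, iteratedFDeriv ℝ (k + 1) (P a) x = 0
  norm_sub_le : ∀ j ≤ k, ∀ a ∈ A, ∀ b ∈ A,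
    ‖iteratedFDeriv ℝ j (P a) a - iteratedFDeriv ℝ j (P b) a‖ ≤
      M * ‖a - b‖ ^ (k - j) * ω ‖a - b‖

/-- The natural size at scale `r` of the `j`-th derivatives of a `C^{k,ω}` function vanishing to
order `k`. -/
def jetScale (k : ℕ) (ω : ℝ → ℝ) (j : ℕ) (r : ℝ) : ℝ := r ^ k * ω r / r ^ j

lemma jetScale_nonneg (hω : IsModulus ω) {j : ℕ} {r : ℝ} (hr : 0 ≤ r) : 0 ≤ jetScale k ω j r :=
  div_nonneg (mul_nonneg (by positivity) (hω.nonneg r hr)) (by positivity)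

lemma jetScale_of_le {j : ℕ} (hj : j ≤ k) {r : ℝ} (hr : 0 < r) :
    jetScale k ω j r = r ^ (k - j) * ω r := by
  rw [jetScale, pow_sub₀ _ hr.ne' hj]
  ring

lemma jetScale_mono (hω : IsModulus ω) {j : ℕ} (hj : j ≤ k) {r s : ℝ} (hr : 0 < r) (hs : r ≤ s) :
    jetScale k ω j r ≤ jetScale k ω j s := by
  rw [jetScale_of_le hj hr, jetScale_of_le hj (hr.trans_le hs)]
  have := hω.mono r s hr.le hs
  have := hω.nonneg r hr.le
  have : 0 ≤ s := hr.le.trans hs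
  gcongr

lemma jetScale_mul_le (hω : IsModulus ω) {j : ℕ} {c r : ℝ} (hc : 1 ≤ c) (hr : 0 < r) :
    jetScale k ω j (c * r) ≤ c ^ (k + 1) * jetScale k ω j r := by
  have h := hω.map_mul_le hc hr.le
  have h0 := hω.nonneg r hr.le
  have hc0 : 0 < c := by linarith
  calc jetScale k ω j (c * r) ≤ (c * r) ^ k * (c * ω r) / (1 * r ^ j) := by
        rw [jetScale, mul_pow c r j]
        have : (1 : ℝ) ≤ c ^ j := one_le_pow₀ hc
        gcongr
    _ = c ^ (k + 1) * jetScale k ω j r := by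
        rw [jetScale]
        ring

lemma jetScale_div_pow {i l : ℕ} {r : ℝ} :
    jetScale k ω i r / r ^ l = jetScale k ω (l + i) r := by
  rw [jetScale, jetScale, div_div, pow_add, mul_comm (r ^ i)]

namespace IsWhitneyField

lemma norm_sub_le_jetScale (hP : IsWhitneyField k ω A M P) (hω : IsModulus ω) (hM : 0 ≤ M)
    {j : ℕ} (hj : j ≤ k + 1) {a b x : Ec n} (ha : a ∈ A) (hb : b ∈ A) {r : ℝ} (hr : 0 < r)
    (hxa : ‖x - a‖ ≤ r) (hxb : ‖x - b‖ ≤ r) :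
    ‖iteratedFDeriv ℝ j (P a) x - iteratedFDeriv ℝ j (P b) x‖ ≤
      (k + 1) * (M * 2 ^ (k + 1)) * jetScale k ω j r := by
  have hsub : ∀ (i : ℕ) z, iteratedFDeriv ℝ i (P a - P b) z =
      iteratedFDeriv ℝ i (P a) z - iteratedFDeriv ℝ i (P b) z := fun i z =>
    iteratedFDeriv_sub_apply ((hP.contDiff a).contDiffAt.of_le (by exact_mod_cast le_top))
      ((hP.contDiff b).contDiffAt.of_le (by exact_mod_cast le_top))
  have hωr := hω.nonneg r hr.le
  have hab : ‖a - b‖ ≤ 2 * r := by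
    have := norm_sub_le_norm_sub_add_norm_sub a x b
    rw [norm_sub_rev a x] at this
    linarith
  have h := norm_iteratedFDeriv_le_of_center (k := k) (Q := P a - P b) (c := a) (r := r)
    (ε := M * 2 ^ (k + 1) * (r ^ k * ω r)) ((hP.contDiff a).sub (hP.contDiff b))
    (fun z => by simp [hsub, hP.iteratedFDeriv_succ]) hr (by positivity) (fun i hi => ?_) hj hxa
  · rw [← hsub]
    refine h.trans_eq ?_
    rw [jetScale]
    ring
  · rw [hsub]
    have h1 := hω.map_le_mul (c := 2) (by norm_num) hr.le (norm_nonneg (a - b)) hab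
    have h2 : (2 : ℝ) ^ (k - i) ≤ 2 ^ k := pow_le_pow_right₀ (by norm_num) (Nat.sub_le _ _)
    have h0 := hω.nonneg _ (norm_nonneg (a - b))
    calc _ ≤ M * ‖a - b‖ ^ (k - i) * ω ‖a - b‖ := hP.norm_sub_le i hi a ha b hb
      _ ≤ M * (2 * r) ^ (k - i) * (2 * ω r) := by gcongr
      _ = M * 2 * (r ^ (k - i) * ω r) * 2 ^ (k - i) := by rw [mul_pow]; ring
      _ ≤ M * 2 * (r ^ (k - i) * ω r) * 2 ^ k := by gcongr
      _ = M * 2 ^ (k + 1) * (r ^ k * ω r) / r ^ i := by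
        rw [← jetScale_of_le hi hr, jetScale]
        ring

end IsWhitneyField

end WhitneyField

section WhitneySum

variable {n k : ℕ} {ω : ℝ → ℝ} {A : Set (Ec n)} {M : ℝ} {P : Ec n → Ec n → ℝ} {ι : Type*}
  {B : ℕ → ℝ} {N : ℕ} {φ : ι → Ec n → ℝ} {a : ι → Ec n}

lemma IsWhitneyPartition.norm_sub_le_of_mem_tsupport (hφ : IsWhitneyPartition A B N φ a) {i : ι}
    {x : Ec n} (hx : x ∈ tsupport (φ i)) : ‖x - a i‖ ≤ 3 * infDist x A := by
  have hcl : IsClosed {y : Ec n | ‖y - a i‖ ≤ 3 * infDist y A} :=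
    isClosed_le (by fun_prop) ((continuous_infDist_pt A).const_mul 3)
  exact closure_minimal (fun y hy => hφ.norm_sub_le i y hy) hcl hx

lemma IsWhitneyPartition.contDiffAt_finsum (hφ : IsWhitneyPartition A B N φ a)
    (hP : ∀ a, ContDiff ℝ ((⊤ : ℕ∞) : WithTop ℕ∞) (P a)) {x : Ec n} (hx : x ∉ A) :
    ContDiffAt ℝ ((⊤ : ℕ∞) : WithTop ℕ∞) (fun y => ∑ᶠ i, φ i y * P (a i) y) x := by
  obtain ⟨S, -, hS⟩ := hφ.locallyFinite x hx
  refine _root_.contDiffAt_finsum (S := S)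
    (fun i => ((hφ.contDiff i).mul (hP (a i))).contDiffAt) ?_
  filter_upwards [hS] with y hy i hi
  simp [hy.1 i hi]

lemma IsWhitneyPartition.norm_iteratedFDeriv_mul_le (hφ : IsWhitneyPartition A B N φ a)
    {i : ι} {Q : Ec n → ℝ} (hQ : ContDiff ℝ ((⊤ : ℕ∞) : WithTop ℕ∞) Q) {x : Ec n} (hx : x ∉ A)
    {j : ℕ} {c : ℝ} (hc : 0 ≤ c)
    (hQb : ‖x - a i‖ ≤ 3 * infDist x A → ∀ l ≤ j,
      ‖iteratedFDeriv ℝ l Q x‖ ≤ c * jetScale k ω l (infDist x A))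
    (h0 : 0 ≤ jetScale k ω j (infDist x A)) :
    ‖iteratedFDeriv ℝ j (fun y => φ i y * Q y) x‖ ≤
      (∑ l ∈ Finset.range (j + 1), (j.choose l : ℝ) * |B l|) * c *
        jetScale k ω j (infDist x A) := by
  refine (_root_.norm_iteratedFDeriv_mul_le (hφ.contDiff i) hQ x
    (by exact_mod_cast le_top)).trans ?_
  rw [Finset.sum_mul, Finset.sum_mul]
  refine Finset.sum_le_sum fun l hl => ?_
  have hl : l ≤ j := by simpa [Nat.lt_succ_iff] using hl
  by_cases hxi : x ∈ tsupport (φ i)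
  · have hd : 0 ≤ infDist x A := infDist_nonneg
    calc _ ≤ (j.choose l : ℝ) * (|B l| / infDist x A ^ l) *
          (c * jetScale k ω (j - l) (infDist x A)) := by
          gcongr
          · exact (hφ.norm_le i l x hx).trans (by gcongr; exact le_abs_self _)
          · exact hQb (hφ.norm_sub_le_of_mem_tsupport hxi) _ (Nat.sub_le _ _)
      _ = (j.choose l : ℝ) * |B l| * c * (jetScale k ω (j - l) (infDist x A) /
          infDist x A ^ l) := by ring
      _ = _ := by rw [jetScale_div_pow, Nat.add_sub_cancel' hl]
  · have h : iteratedFDeriv ℝ l (φ i) x = 0 := by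
      by_contra h
      exact hxi (support_iteratedFDeriv_subset l h)
    rw [h, norm_zero, mul_zero, zero_mul]
    positivity

lemma IsWhitneyField.exists_norm_iteratedFDeriv_finsum_sub_le (hP : IsWhitneyField k ω A M P)
    (hω : IsModulus ω) (hM : 0 ≤ M) (hA : IsClosed A) (hφ : IsWhitneyPartition A B N φ a)
    (j : ℕ) (hj : j ≤ k + 1) :
    ∃ c : ℝ, 0 ≤ c ∧ ∀ x ∉ A, ∀ b ∈ A, ‖x - b‖ = infDist x A →
      ‖iteratedFDeriv ℝ j (fun y => ∑ᶠ i, φ i y * P (a i) y) x - iteratedFDeriv ℝ j (P b) x‖ ≤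
        c * jetScale k ω j (infDist x A) := by
  set c₀ : ℝ := (k + 1) * (M * 2 ^ (k + 1)) * 3 ^ (k + 1) with hc₀
  have hc₀0 : 0 ≤ c₀ := by positivity
  refine ⟨N * ((∑ l ∈ Finset.range (j + 1), (j.choose l : ℝ) * |B l|) * c₀), by positivity,
    fun x hx b hb hxb => ?_⟩
  have hd : 0 < infDist x A := (hA.notMem_iff_infDist_pos ⟨b, hb⟩).1 hx
  have h0 := jetScale_nonneg (k := k) (j := j) hω hd.le
  obtain ⟨S, hSN, hS⟩ := hφ.locallyFinite x hx
  have hsm : ∀ i, ContDiff ℝ ((⊤ : ℕ∞) : WithTop ℕ∞) (P (a i) - P b) := fun i =>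
    (hP.contDiff (a i)).sub (hP.contDiff b)
  have hW : (fun y => ∑ᶠ i, φ i y * P (a i) y) - P b =ᶠ[nhds x]
      fun y => ∑ᶠ i, φ i y * (P (a i) - P b) y := by
    filter_upwards [hS] with y hy
    have hsupp : ∀ Q : ι → ℝ, ∑ᶠ i, φ i y * Q i = ∑ i ∈ S, φ i y * Q i := fun Q =>
      finsum_eq_sum_of_support_subset _ fun i hi => by
        by_contra hiS
        exact hi (by simp [hy.1 i hiS])
    simp only [Pi.sub_apply, hsupp]
    simp only [mul_sub, Finset.sum_sub_distrib, ← Finset.sum_mul, hy.2, one_mul]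
  rw [← iteratedFDeriv_sub_apply
    ((hφ.contDiffAt_finsum hP.contDiff hx).of_le (by exact_mod_cast le_top))
    ((hP.contDiff b).contDiffAt.of_le (by exact_mod_cast le_top)),
    (hW.iteratedFDeriv ℝ j).self_of_nhds, mul_assoc]
  refine norm_iteratedFDeriv_finsum_le (by positivity)
    (fun i => ((hφ.contDiff i).mul (hsm i)).contDiffAt.of_le (by exact_mod_cast le_top))
    (S := S) ?_ hSN fun i => ?_
  · filter_upwards [hS] with y hy i hi
    simp [hy.1 i hi]
  · refine hφ.norm_iteratedFDeriv_mul_le (hsm i) hx hc₀0 (fun hxi l hl => ?_) h0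
    rw [iteratedFDeriv_sub_apply
      ((hP.contDiff _).contDiffAt.of_le (by exact_mod_cast le_top))
      ((hP.contDiff b).contDiffAt.of_le (by exact_mod_cast le_top))]
    refine (hP.norm_sub_le_jetScale hω hM (hl.trans hj) (hφ.mem i) hb
      (r := 3 * infDist x A) (by positivity) hxi (by linarith)).trans ?_
    rw [hc₀, mul_assoc _ (3 ^ (k + 1) : ℝ)]
    gcongr
    exact jetScale_mul_le hω (by norm_num) hd

end WhitneySum

section WhitneyJet

variable {n k : ℕ} {ω : ℝ → ℝ} {A : Set (Ec n)} {M c : ℝ} {P : Ec n → Ec n → ℝ} {W : Ec n → ℝ}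

open Classical in
/-- The jet of the polynomials `P a` at the points `a ∈ A`, and the jet of `W` elsewhere. -/
def whitneyJet (A : Set (Ec n)) (P : Ec n → Ec n → ℝ) (W : Ec n → ℝ) (x : Ec n) :
    FormalMultilinearSeries ℝ (Ec n) ℝ := fun j =>
  if x ∈ A then iteratedFDeriv ℝ j (P x) x else iteratedFDeriv ℝ j W x

lemma whitneyJet_of_mem {x : Ec n} (hx : x ∈ A) (j : ℕ) :
    whitneyJet A P W x j = iteratedFDeriv ℝ j (P x) x := if_pos hx

lemma whitneyJet_of_notMem {x : Ec n} (hx : x ∉ A) (j : ℕ) :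
    whitneyJet A P W x j = iteratedFDeriv ℝ j W x := if_neg hx

lemma hasFDerivAt_iteratedFDeriv {Q : Ec n → ℝ} {x : Ec n}
    (hQ : ContDiffAt ℝ ((⊤ : ℕ∞) : WithTop ℕ∞) Q x) (j : ℕ) :
    HasFDerivAt (iteratedFDeriv ℝ j Q) (iteratedFDeriv ℝ (j + 1) Q x).curryLeft x :=
  (hQ.differentiableAt_iteratedFDeriv (by exact_mod_cast WithTop.coe_lt_top j)).hasFDerivAt

lemma exists_mem_norm_sub_eq_infDist (hA : IsClosed A) (hne : A.Nonempty) (x : Ec n) :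
    ∃ b ∈ A, ‖x - b‖ = infDist x A := by
  obtain ⟨b, hb, h⟩ := hA.exists_infDist_eq_dist hne x
  exact ⟨b, hb, by rw [h, dist_eq_norm]⟩

/-- `W` is smooth off `A`, where it is approximated to order `k + 1` by the polynomials `P b`
attached to nearest points `b`. -/
structure IsWhitneyApprox (k : ℕ) (ω : ℝ → ℝ) (A : Set (Ec n)) (c : ℝ) (P : Ec n → Ec n → ℝ)
    (W : Ec n → ℝ) : Prop where
  contDiffAt : ∀ x ∉ A, ContDiffAt ℝ ((⊤ : ℕ∞) : WithTop ℕ∞) W x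
  norm_sub_le : ∀ j ≤ k + 1, ∀ x ∉ A, ∀ b ∈ A, ‖x - b‖ = infDist x A →
    ‖iteratedFDeriv ℝ j W x - iteratedFDeriv ℝ j (P b) x‖ ≤ c * jetScale k ω j (infDist x A)

namespace IsWhitneyApprox

lemma exists_norm_whitneyJet_sub_le (hW : IsWhitneyApprox k ω A c P W) (hc : 0 ≤ c)
    (hP : IsWhitneyField k ω A M P) (hω : IsModulus ω) (hM : 0 ≤ M) (hA : IsClosed A) :
    ∃ K, 0 ≤ K ∧ ∀ j ≤ k, ∀ a ∈ A, ∀ x, ‖whitneyJet A P W x j - iteratedFDeriv ℝ j (P a) x‖ ≤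
      K * (‖x - a‖ ^ (k - j) * ω ‖x - a‖) := by
  set c₀ : ℝ := (k + 1) * (M * 2 ^ (k + 1)) with hc₀
  have hc₀0 : 0 ≤ c₀ := by positivity
  refine ⟨M + c + c₀, by positivity, fun j hj a ha x => ?_⟩
  have hωx := hω.nonneg _ (norm_nonneg (x - a))
  by_cases hx : x ∈ A
  · rw [whitneyJet_of_mem hx]
    calc _ ≤ M * ‖x - a‖ ^ (k - j) * ω ‖x - a‖ := hP.norm_sub_le j hj x hx a ha
      _ = M * (‖x - a‖ ^ (k - j) * ω ‖x - a‖) := by ring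
      _ ≤ _ := by
        gcongr
        linarith
  · rw [whitneyJet_of_notMem hx]
    obtain ⟨b, hb, hxb⟩ := exists_mem_norm_sub_eq_infDist hA ⟨a, ha⟩ x
    have hd : 0 < infDist x A := (hA.notMem_iff_infDist_pos ⟨a, ha⟩).1 hx
    have hda : infDist x A ≤ ‖x - a‖ := by
      rw [← dist_eq_norm]
      exact infDist_le_dist_of_mem ha
    have hr := hd.trans_le hda
    have h1 := hW.norm_sub_le j (by omega) x hx b hb hxb
    have h2 := hP.norm_sub_le_jetScale hω hM (j := j) (by omega) hb ha hr (hxb.trans_le hda) le_rfl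
    have h3 := jetScale_mono hω hj hd hda
    have h4 := norm_sub_le_norm_sub_add_norm_sub (iteratedFDeriv ℝ j W x)
      (iteratedFDeriv ℝ j (P b) x) (iteratedFDeriv ℝ j (P a) x)
    have h5 := jetScale_nonneg (k := k) (j := j) hω hr.le
    rw [← jetScale_of_le hj hr]
    nlinarith [mul_le_mul_of_nonneg_left h3 hc, mul_nonneg hM h5]

lemma whitneyJet_eventuallyEq (hA : IsClosed A) {x : Ec n} (hx : x ∉ A) (j : ℕ) :
    (fun y => whitneyJet A P W y j) =ᶠ[nhds x] iteratedFDeriv ℝ j W := by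
  filter_upwards [hA.isOpen_compl.mem_nhds hx] with y hy using whitneyJet_of_notMem hy j

lemma tendsto_remainder (hω : IsModulus ω) (K : ℝ) (m : ℕ) (a : Ec n) :
    Tendsto (fun x => K * (‖x - a‖ ^ m * ω ‖x - a‖)) (nhds a) (nhds 0) := by
  have h : Continuous fun x : Ec n => K * (‖x - a‖ ^ m * ω ‖x - a‖) :=
    continuous_const.mul (Continuous.mul (by fun_prop)
      (hω.continuous_comp (by fun_prop) fun _ => norm_nonneg _))
  simpa [hω.map_zero] using h.tendsto a

lemma hasFTaylorSeriesUpTo (hW : IsWhitneyApprox k ω A c P W) (hc : 0 ≤ c)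
    (hP : IsWhitneyField k ω A M P) (hω : IsModulus ω) (hM : 0 ≤ M) (hA : IsClosed A) :
    HasFTaylorSeriesUpTo k (fun x => (whitneyJet A P W x 0).curry0) (whitneyJet A P W) := by
  obtain ⟨K, hK, hKb⟩ := hW.exists_norm_whitneyJet_sub_le hc hP hω hM hA
  refine ⟨fun x => rfl, fun j hj x => ?_, fun j hj => continuous_iff_continuousAt.2 fun x => ?_⟩
  · have hj : j < k := by exact_mod_cast hj
    by_cases hx : x ∈ A
    · have h0 : HasFDerivAt (fun y => whitneyJet A P W y j - iteratedFDeriv ℝ j (P x) y)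
          (0 : Ec n →L[ℝ] _) x := by
        rw [hasFDerivAt_iff_isLittleO]
        refine Asymptotics.isLittleO_iff.2 fun ε hε => ?_
        filter_upwards [(tendsto_remainder hω K (k - (j + 1)) x).eventually (gt_mem_nhds hε)]
          with y hy
        rw [whitneyJet_of_mem hx, sub_self, sub_zero, zero_apply, sub_zero]
        calc _ ≤ K * (‖y - x‖ ^ (k - j) * ω ‖y - x‖) := hKb j hj.le x hx y
          _ = K * (‖y - x‖ ^ (k - (j + 1)) * ω ‖y - x‖) * ‖y - x‖ := by
            rw [show k - j = k - (j + 1) + 1 by omega]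
            ring
          _ ≤ ε * ‖y - x‖ := by gcongr
      have h1 := h0.add (hasFDerivAt_iteratedFDeriv ((hP.contDiff x).contDiffAt (x := x)) j)
      rw [zero_add] at h1
      simpa [whitneyJet_of_mem hx, Pi.add_def] using h1
    · have h1 := hasFDerivAt_iteratedFDeriv (hW.contDiffAt x hx) j
      rw [whitneyJet_of_notMem hx]
      exact h1.congr_of_eventuallyEq (whitneyJet_eventuallyEq hA hx j)
  · have hj : j ≤ k := by exact_mod_cast hj
    by_cases hx : x ∈ A
    · have h0 : Tendsto (fun y => whitneyJet A P W y j - iteratedFDeriv ℝ j (P x) y)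
          (nhds x) (nhds 0) :=
        squeeze_zero_norm (fun y => hKb j hj x hx y) (tendsto_remainder hω K (k - j) x)
      have h1 := h0.add ((hP.contDiff x).continuous_iteratedFDeriv (m := j)
        (by exact_mod_cast le_top)).continuousAt
      simpa [ContinuousAt, whitneyJet_of_mem hx] using h1
    · exact (hasFDerivAt_iteratedFDeriv (hW.contDiffAt x hx) j).continuousAt.congr
        (whitneyJet_eventuallyEq hA hx j).symm

lemma norm_iteratedFDeriv_succ_le (hW : IsWhitneyApprox k ω A c P W) (hc : 0 ≤ c)
    (hP : IsWhitneyField k ω A M P) (hω : IsModulus ω) (hA : IsClosed A) (hne : A.Nonempty)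
    {s : ℝ} (hs : 0 < s) {x : Ec n} (hx : s ≤ infDist x A) :
    ‖iteratedFDeriv ℝ (k + 1) W x‖ ≤ c * ω s / s := by
  have hd : 0 < infDist x A := hs.trans_le hx
  obtain ⟨b, hb, hxb⟩ := exists_mem_norm_sub_eq_infDist hA hne x
  have h := hW.norm_sub_le (k + 1) le_rfl x ((hA.notMem_iff_infDist_pos hne).2 hd) b hb hxb
  rw [hP.iteratedFDeriv_succ, sub_zero] at h
  have h1 := hω.mul_le_mul hs hx
  calc _ ≤ c * jetScale k ω (k + 1) (infDist x A) := h
    _ = c * (ω (infDist x A) / infDist x A) := by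
      rw [jetScale]
      field_simp
      ring
    _ ≤ c * (ω s / s) := by
      refine mul_le_mul_of_nonneg_left ?_ hc
      rw [div_le_div_iff₀ hd hs]
      linarith
    _ = _ := by ring

lemma exists_norm_whitneyJet_sub_whitneyJet_le (hW : IsWhitneyApprox k ω A c P W) (hc : 0 ≤ c)
    (hP : IsWhitneyField k ω A M P) (hω : IsModulus ω) (hM : 0 ≤ M) (hA : IsClosed A)
    (hne : A.Nonempty) :
    ∃ K, ∀ x y, ‖whitneyJet A P W x k - whitneyJet A P W y k‖ ≤ K * ω ‖x - y‖ := by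
  obtain ⟨K, hK, hKb⟩ := hW.exists_norm_whitneyJet_sub_le hc hP hω hM hA
  refine ⟨c + 5 * K, fun x y => ?_⟩
  rcases eq_or_ne x y with rfl | hxy
  · simp [hω.map_zero]
  have hs : 0 < ‖x - y‖ := norm_pos_iff.2 (sub_ne_zero.2 hxy)
  have h0 := hω.nonneg _ hs.le
  rcases le_or_gt (2 * ‖x - y‖) (infDist y A) with hd | hd
  · have hball : ∀ z, ‖z - y‖ ≤ ‖x - y‖ → ‖x - y‖ ≤ infDist z A := by
      intro z hz
      have := infDist_le_infDist_add_dist (s := A) (x := y) (y := z)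
      rw [dist_comm, dist_eq_norm] at this
      linarith
    have hout : ∀ z, ‖z - y‖ ≤ ‖x - y‖ → z ∉ A := fun z hz =>
      (hA.notMem_iff_infDist_pos hne).2 (hs.trans_le (hball z hz))
    rw [whitneyJet_of_notMem (hout x le_rfl), whitneyJet_of_notMem (hout y (by simp))]
    refine (norm_iteratedFDeriv_sub_le_of_ball (fun z hz => hW.contDiffAt z (hout z hz))
      (fun z hz => hW.norm_iteratedFDeriv_succ_le hc hP hω hA hne hs (hball z hz))
      (by simp) le_rfl).trans ?_
    rw [div_mul_cancel₀ _ hs.ne']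
    gcongr
    linarith
  · obtain ⟨b, hb, hyb⟩ := exists_mem_norm_sub_eq_infDist hA hne y
    have hxb : ‖x - b‖ ≤ 3 * ‖x - y‖ := by
      linarith [norm_sub_le_norm_sub_add_norm_sub x y b]
    have h1 := hKb k le_rfl b hb x
    have h2 := hKb k le_rfl b hb y
    have h3 := norm_iteratedFDeriv_sub_le_of_ball (j := k) (x := y) (y := x) (c := y) (b := 0)
      (r := ‖x - y‖) (fun z _ => (hP.contDiff b).contDiffAt)
      (fun z _ => by simp [hP.iteratedFDeriv_succ]) (by simp) le_rfl
    have h4 := hω.map_le_mul (by norm_num) hs.le (norm_nonneg _) hxb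
    have h5 := hω.map_le_mul (c := 2) (by norm_num) hs.le (norm_nonneg _) (hyb.trans_le hd.le)
    have h6 := norm_sub_le_norm_sub_add_norm_sub (whitneyJet A P W x k)
      (iteratedFDeriv ℝ k (P b) x) (whitneyJet A P W y k)
    have h7 := norm_sub_le_norm_sub_add_norm_sub (iteratedFDeriv ℝ k (P b) x)
      (iteratedFDeriv ℝ k (P b) y) (whitneyJet A P W y k)
    rw [norm_sub_rev (iteratedFDeriv ℝ k (P b) y)] at h7
    simp only [Nat.sub_self, pow_zero, one_mul, zero_mul] at h1 h2 h3
    nlinarith [mul_le_mul_of_nonneg_left h4 hK, mul_le_mul_of_nonneg_left h5 hK,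
      mul_nonneg hc h0]

end IsWhitneyApprox

/-- Whitney's extension theorem for closed sets, in terms of fields of polynomials. -/
theorem IsWhitneyField.exists_extension (hP : IsWhitneyField k ω A M P) (hω : IsModulus ω)
    (hM : 0 ≤ M) (hA : IsClosed A) (hne : A.Nonempty) :
    ∃ F : Ec n → ℝ, ContDiff ℝ k F ∧
      (∃ K : ℝ, ∀ x y : Ec n,
        ‖iteratedFDeriv ℝ k F x - iteratedFDeriv ℝ k F y‖ ≤ K * ω ‖x - y‖) ∧
      ∀ a ∈ A, ∀ j ≤ k, iteratedFDeriv ℝ j F a = iteratedFDeriv ℝ j (P a) a := by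
  obtain ⟨B, N, φ, a, hφ⟩ := exists_isWhitneyPartition hA hne
  choose! b hb0 hb using hP.exists_norm_iteratedFDeriv_finsum_sub_le hω hM hA hφ
  have hbmem : ∀ j ∈ Finset.range (k + 2), 0 ≤ b j := fun j hj =>
    hb0 j (Nat.lt_succ_iff.1 (Finset.mem_range.1 hj))
  have hc : 0 ≤ ∑ j ∈ Finset.range (k + 2), b j := Finset.sum_nonneg hbmem
  have hW : IsWhitneyApprox k ω A (∑ j ∈ Finset.range (k + 2), b j) P
      fun y => ∑ᶠ i, φ i y * P (a i) y := by
    refine ⟨fun x hx => hφ.contDiffAt_finsum hP.contDiff hx, fun j hj x hx p hp hxp => ?_⟩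
    refine (hb j hj x hx p hp hxp).trans ?_
    have := jetScale_nonneg (k := k) (j := j) hω (infDist_nonneg (x := x) (s := A))
    gcongr
    exact Finset.single_le_sum hbmem (Finset.mem_range.2 (by omega))
  have hT := hW.hasFTaylorSeriesUpTo hc hP hω hM hA
  have heq : ∀ j ≤ k, ∀ x, iteratedFDeriv ℝ j _ x = whitneyJet A P _ x j := fun j hj x =>
    (hT.eq_iteratedFDeriv (by exact_mod_cast hj) x).symm
  obtain ⟨K, hK⟩ := hW.exists_norm_whitneyJet_sub_whitneyJet_le hc hP hω hM hA hne
  refine ⟨_, HasFTaylorSeriesUpTo.contDiff (n := (k : ℕ∞)) (by exact_mod_cast hT),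
    ⟨K, fun x y => ?_⟩, fun p hp j hj => ?_⟩
  · rw [heq k le_rfl, heq k le_rfl]
    exact hK x y
  · rw [heq j hj, whitneyJet_of_mem hp]

end WhitneyJet

/-- The Taylor polynomials of a Whitney jet form a Whitney field. -/
lemma isWhitneyField_taylorFamily {n k : ℕ} {ω : ℝ → ℝ} (hω : IsModulus ω) {A : Set (Ec n)}
    {g : (Fin n →₀ ℕ) → Ec n → ℝ} {M : ℝ} (hM : 0 ≤ M)
    (hg : ∀ α : Fin n →₀ ℕ, mdeg α ≤ k → ∀ x ∈ A, ∀ y ∈ A,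
      |g α x - ∑ β ∈ multiIdxLe n (k - mdeg α), g (α + β) y / mfact β * mpow β (x - y)| ≤
        M * ‖x - y‖ ^ (k - mdeg α) * ω ‖x - y‖) :
    IsWhitneyField k ω A (((n : ℝ) + 1) ^ k * M) fun a => taylorFamily k (fun α => g α a) a 0 := by
  refine ⟨fun a => (isDerivFamily_taylorFamily k _ a).contDiff 0,
    fun a x => iteratedFDeriv_taylorFamily_of_lt k _ a x (Nat.lt_succ_self k),
    fun j hj a ha b hb => ?_⟩
  have h0 := hω.nonneg _ (norm_nonneg (a - b))
  refine (norm_iteratedFDeriv_sub_le_of_family (isDerivFamily_taylorFamily k _ a)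
    (isDerivFamily_taylorFamily k _ b) (c := M * ‖a - b‖ ^ (k - j) * ω ‖a - b‖) (by positivity)
    fun α hα => ?_).trans ?_
  · rw [taylorFamily_self k _ a (hα.trans_le hj), taylorFamily_eq k _ b (hα.trans_le hj), ← hα]
    exact hg α (hα.trans_le hj) a ha b hb
  · have h1 : (n : ℝ) ^ j ≤ ((n : ℝ) + 1) ^ k :=
      (pow_le_pow_left₀ (by positivity) (by linarith) j).trans
        (pow_le_pow_right₀ (by linarith [Nat.cast_nonneg (α := ℝ) n]) hj)
    calc _ ≤ ((n : ℝ) + 1) ^ k * (M * ‖a - b‖ ^ (k - j) * ω ‖a - b‖) := by gcongr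
      _ = _ := by ring

/-- uniform Whitney extension theorem on arbitrary sets: let `ω` be a
modulus of continuity, `C ⊆ ℝⁿ` arbitrary, and `{f_α}_{|α|≤k}` real functions on `C`
satisfying the Whitney jet conditions
`f_α(x) = ∑_{|β| ≤ k-|α|} f_{α+β}(y)/β! (x-y)^β + R_α(x,y)` with `|f_α(x)| ≤ M` and
`|R_α(x,y)| ≤ M |x-y|^{k-|α|} ω(|x-y|)` on `C`. Then there exists
`F ∈ C^{k,ω}(ℝⁿ;ℝ)` with `D^α F = f_α` on `C` for all `|α| ≤ k`. -/
theorem whitney_uniform {n k : ℕ} (ω : ℝ → ℝ)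
    (hω_nonneg : ∀ s, 0 ≤ s → 0 ≤ ω s)
    (hω_mono : ∀ a b, 0 ≤ a → a ≤ b → ω a ≤ ω b)
    (hω_concave : ConcaveOn ℝ (Ici (0 : ℝ)) ω)
    (hω_zero : Tendsto ω (nhdsWithin 0 (Ioi 0)) (nhds 0))
    (C : Set (Ec n)) (f : (Fin n →₀ ℕ) → Ec n → ℝ) (M : ℝ) (hM : 0 < M)
    (hbound : ∀ α : Fin n →₀ ℕ, mdeg α ≤ k → ∀ x ∈ C, |f α x| ≤ M)
    (hjet : ∀ α : Fin n →₀ ℕ, mdeg α ≤ k → ∀ x ∈ C, ∀ y ∈ C,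
      |f α x - ∑ β ∈ multiIdxLe n (k - mdeg α), f (α + β) y / mfact β * mpow β (x - y)| ≤
        M * ‖x - y‖ ^ (k - mdeg α) * ω ‖x - y‖) :
    ∃ F : Ec n → ℝ,
      ContDiff ℝ k F ∧
      (∃ K : ℝ, ∀ x y : Ec n,
        ‖iteratedFDeriv ℝ k F x - iteratedFDeriv ℝ k F y‖ ≤ K * ω ‖x - y‖) ∧
      ∀ α : Fin n →₀ ℕ, mdeg α ≤ k → ∀ x ∈ C, pderMulti α F x = f α x := by
  have hω : IsModulus ω := ⟨hω_nonneg, hω_mono, hω_concave, hω_zero⟩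
  rcases C.eq_empty_or_nonempty with rfl | hC
  · exact ⟨fun _ => 0, contDiff_const, ⟨0, by simp⟩, by simp⟩
  obtain ⟨g, hgf, hg⟩ := exists_jet_closure hω C f M hbound hjet
  obtain ⟨F, hF, hFω, hFg⟩ := (isWhitneyField_taylorFamily hω hM.le hg).exists_extension hω
    (by positivity) isClosed_closure hC.closure
  refine ⟨F, hF, hFω, fun α hα x hx => ?_⟩
  have hT := isDerivFamily_taylorFamily k (fun α => g α x) x
  rw [pderMulti_eq_of_iteratedFDeriv_eq hF ((hT.contDiff 0).of_le (by exact_mod_cast le_top))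
    (hFg x (subset_closure hx)) α hα, hT.pderMulti_eq, taylorFamily_self k _ x hα, hgf α hα x hx]

end
end
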